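/- arXiv:1003.0475 — 4 statements merged into one kernel-verified Lean document; each statement's English description precedes it below -/
import Mathlib

section
/- Let n ≥ 2 and let A be an n×n real symmetric matrix with trace zero. Then the n−1 matrices A, H_2(A), H_3(A), …, H_{n−1}(A) are linearly dependent over R if and only if A has a repeated eigenvalue (equivalently, the wedge product A ∧ H_2(A) ∧ ⋯ ∧ H_{n−1}(A) in ⋀^{n−1} N is zero if and only if A ∈ F). -/
open Matrix BigOperators

/-- A real symmetric matrix is Hermitian. -/
theorem isHermitian_of_isSymm {n : ℕ} {A : Matrix (Fin n) (Fin n) ℝ} (h : A.IsSymm) :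
    A.IsHermitian := by
  rw [Matrix.IsHermitian, Matrix.conjTranspose_eq_transpose_of_trivial]
  exact h

/-- The discriminant of a real symmetric (Hermitian) matrix: the product of the squared
differences of its eigenvalues. -/
noncomputable def disc {n : ℕ} (A : Matrix (Fin n) (Fin n) ℝ) (hA : A.IsHermitian) : ℝ :=
  ∏ i : Fin n, ∏ j ∈ Finset.Ioi i, (hA.eigenvalues i - hA.eigenvalues j) ^ 2

/-- The space `N` of trace-zero real symmetric `n × n` matrices, as a submodule. -/
def symTraceless (n : ℕ) : Submodule ℝ (Matrix (Fin n) (Fin n) ℝ) where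
  carrier := {A | A.IsSymm ∧ A.trace = 0}
  add_mem' := by
    rintro A B ⟨hA1, hA2⟩ ⟨hB1, hB2⟩
    refine ⟨?_, ?_⟩
    · rw [Matrix.IsSymm, Matrix.transpose_add, hA1, hB1]
    · rw [Matrix.trace_add, hA2, hB2, add_zero]
  zero_mem' := ⟨by rw [Matrix.IsSymm, Matrix.transpose_zero], by simp⟩
  smul_mem' := by
    rintro c A ⟨h1, h2⟩
    refine ⟨?_, ?_⟩
    · rw [Matrix.IsSymm, Matrix.transpose_smul, h1]
    · rw [Matrix.trace_smul, h2, smul_zero]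

theorem mem_symTraceless {n : ℕ} {A : Matrix (Fin n) (Fin n) ℝ} :
    A ∈ symTraceless n ↔ A.IsSymm ∧ A.trace = 0 := Iff.rfl

/-- The eigenvalues of a trace-zero real symmetric matrix. -/
noncomputable def eigsN {n : ℕ} (A : symTraceless n) : Fin n → ℝ :=
  (isHermitian_of_isSymm (mem_symTraceless.mp A.2).1).eigenvalues

/-- A trace-zero symmetric matrix is degenerate if it has a repeated eigenvalue. -/
def Degen {n : ℕ} (A : symTraceless n) : Prop :=
  ∃ i j : Fin n, i ≠ j ∧ eigsN A i = eigsN A j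

/-- The discriminant, as a function on trace-zero symmetric matrices. -/
noncomputable def discN {n : ℕ} (A : symTraceless n) : ℝ :=
  ∏ i : Fin n, ∏ j ∈ Finset.Ioi i, (eigsN A i - eigsN A j) ^ 2

/-- Evaluation of a polynomial in the matrix entries at a matrix. -/
noncomputable def evalMat {n : ℕ} (p : MvPolynomial (Fin n × Fin n) ℝ)
    (A : Matrix (Fin n) (Fin n) ℝ) : ℝ :=
  MvPolynomial.eval (fun ij => A ij.1 ij.2) p

/-- The action `A ↦ gᵀ A g` of an orthogonal matrix on trace-zero symmetric matrices. -/
def soConj {n : ℕ} (g : Matrix (Fin n) (Fin n) ℝ) (hg : gᵀ * g = 1)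
    (A : symTraceless n) : symTraceless n :=
  ⟨gᵀ * A.1 * g, by
    obtain ⟨h1, h2⟩ := mem_symTraceless.mp A.2
    refine mem_symTraceless.mpr ⟨?_, ?_⟩
    · rw [Matrix.IsSymm, Matrix.transpose_mul, Matrix.transpose_mul,
        Matrix.transpose_transpose, h1, Matrix.mul_assoc]
    · rw [Matrix.trace_mul_cycle, _root_.mul_eq_one_comm.mp hg,
        Matrix.one_mul, h2]⟩

/-- `H_i(A) = A^i - (Tr(A^i)/n)·I`. -/
noncomputable def Hmat {n : ℕ} (A : Matrix (Fin n) (Fin n) ℝ) (i : ℕ) :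
    Matrix (Fin n) (Fin n) ℝ :=
  A ^ i - ((A ^ i).trace / (n : ℝ)) • 1

theorem aux_aeval_iff {n : ℕ} {A : Matrix (Fin n) (Fin n) ℝ} (hA : A.IsHermitian)
    (p : Polynomial ℝ) :
    Polynomial.aeval A p = 0 ↔ ∀ i, p.eval (hA.eigenvalues i) = 0 := by
  have hs := hA.spectral_theorem
  set φ := Unitary.conjStarAlgAut ℝ (Matrix (Fin n) (Fin n) ℝ) hA.eigenvectorUnitary with hφ
  have h1 : Polynomial.aeval A p
      = φ (Matrix.diagonal (fun i => p.eval (hA.eigenvalues i))) := by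
    have e : A = (φ.toAlgEquiv : _ →ₐ[ℝ] _)
        (Matrix.diagonalAlgHom ℝ (hA.eigenvalues)) := by
      conv_lhs => rw [hs]
      rfl
    conv_lhs => rw [e]
    rw [Polynomial.aeval_algHom_apply, Polynomial.aeval_algHom_apply]
    have : (Polynomial.aeval hA.eigenvalues) p = fun i => p.eval (hA.eigenvalues i) := by
      ext i
      simp
    rw [this]
    rfl
  rw [h1, map_eq_zero_iff φ φ.injective]
  constructor
  · intro h i
    have := congrFun (congrFun h i) i
    simpa using this
  · intro h
    ext i j
    simp [Matrix.diagonal_apply, h]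

theorem not_linearIndependent_iff_degenerate (n : ℕ) (hn : 2 ≤ n)
    (A : Matrix (Fin n) (Fin n) ℝ) (hA : A.IsSymm) (h0 : A.trace = 0) :
    (¬ LinearIndependent ℝ (fun i : Fin (n - 1) => Hmat A (i.1 + 1))) ↔
      ∃ i j : Fin n, i ≠ j ∧
        (isHermitian_of_isSymm hA).eigenvalues i = (isHermitian_of_isSymm hA).eigenvalues j := by
  obtain ⟨m, rfl⟩ : ∃ m, n = m + 1 := ⟨n - 1, by omega⟩
  have hH := isHermitian_of_isSymm hA
  change (¬ LinearIndependent ℝ (fun i : Fin m => Hmat A (i.1 + 1))) ↔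
    ∃ i j, i ≠ j ∧ hH.eigenvalues i = hH.eigenvalues j
  rw [Fintype.linearIndependent_iff]
  constructor
  · intro h
    by_contra hne
    have hinj : Function.Injective hH.eigenvalues := by
      intro i j hij
      by_contra hc
      exact hne ⟨i, j, hc, hij⟩
    apply h
    intro g hg
    set p : Polynomial ℝ := (∑ i : Fin m, Polynomial.monomial (i.1 + 1) (g i)) -
      Polynomial.C (∑ i : Fin m, g i * ((A ^ (i.1 + 1)).trace / ((m + 1 : ℕ) : ℝ))) with hp
    have hpA : Polynomial.aeval A p = 0 := by
      rw [← hg, hp]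
      simp only [map_sub, map_sum, Polynomial.aeval_monomial, Polynomial.aeval_C, Hmat, smul_sub,
        Finset.sum_sub_distrib, Algebra.algebraMap_eq_smul_one, smul_mul_assoc, one_mul,
        smul_smul, Finset.sum_smul]
    have hdeg : p.natDegree < m + 1 := by
      rw [Nat.lt_succ_iff, hp]
      refine (Polynomial.natDegree_sub_le _ _).trans (max_le ?_ ((Polynomial.natDegree_C _).le.trans (Nat.zero_le _)))
      refine Polynomial.natDegree_sum_le_of_forall_le _ _ fun i _ => ?_
      exact (Polynomial.natDegree_monomial_le _).trans (by omega)
    have hp0 : p = 0 :=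
      Polynomial.eq_zero_of_natDegree_lt_card_of_eval_eq_zero p hinj
        ((aux_aeval_iff hH p).1 hpA) (by simpa using hdeg)
    intro i
    have := congrArg (fun q => Polynomial.coeff q (i.1 + 1)) hp0
    simpa [hp, Polynomial.finsetSum_coeff, Polynomial.coeff_monomial, Polynomial.coeff_C,
      Fin.val_inj] using this
  · rintro ⟨i, j, hij, he⟩ hli
    set s := Finset.univ.image hH.eigenvalues with hs
    have hcard : s.card ≤ m := by
      have : s.card < (Finset.univ : Finset (Fin (m + 1))).card := by
        refine lt_of_le_of_ne Finset.card_image_le fun hc => hij ?_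
        exact (Finset.card_image_iff.1 hc) (by simp) (by simp) he
      simpa [Nat.lt_succ_iff] using this
    set r : Polynomial ℝ := ∏ μ ∈ s, (Polynomial.X - Polynomial.C μ) with hr
    have hrm : r.Monic := Polynomial.monic_prod_of_monic _ _ fun μ _ => Polynomial.monic_X_sub_C μ
    have hrd : r.natDegree = s.card := by
      simp [hr]
    set q : Polynomial ℝ := r * Polynomial.X ^ (m - s.card) with hq
    have hqm : q.Monic := hrm.mul (Polynomial.monic_X_pow _)
    have hqd : q.natDegree = m := by
      rw [hq, hrm.natDegree_mul (Polynomial.monic_X_pow _), hrd, Polynomial.natDegree_X_pow]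
      omega
    have hqA : Polynomial.aeval A q = 0 := by
      rw [aux_aeval_iff hH]
      intro k
      rw [hq, Polynomial.eval_mul, hr, Polynomial.eval_prod,
        Finset.prod_eq_zero (i := hH.eigenvalues k) (by simp [hs]) (by simp), zero_mul]
    have hne : ((m + 1 : ℕ) : ℝ) ≠ 0 := by positivity
    rw [Polynomial.aeval_eq_sum_range, hqd, Finset.sum_range_succ', Finset.sum_range] at hqA
    have hz := hli (fun i => q.coeff (i.1 + 1)) (by
      have ht := congrArg Matrix.trace hqA
      simp only [Matrix.trace_add, Matrix.trace_sum, Matrix.trace_smul, pow_zero,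
        Matrix.trace_one, Fintype.card_fin, Matrix.trace_zero, smul_eq_mul] at ht
      simp only [Hmat, smul_sub, Finset.sum_sub_distrib, smul_smul, ← Finset.sum_smul]
      rw [eq_neg_of_add_eq_zero_left hqA]
      have : ∑ x : Fin m, q.coeff (x.1 + 1) * ((A ^ (x.1 + 1)).trace / ((m + 1 : ℕ) : ℝ))
          = - q.coeff 0 := by
        simp only [← mul_div_assoc, ← Finset.sum_div]
        rw [div_eq_iff hne]
        linarith
      rw [this]
      simp)
    have := hz ⟨m - 1, by omega⟩
    have h2 : m - 1 + 1 = m := by omega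
    simp only [h2] at this
    have h3 := hqm.coeff_natDegree
    rw [hqd, this] at h3
    exact zero_ne_one h3
end

section
/- Let n ≥ 2 and set D = C(2n−1, n−1) − C(2n−3, n−1) (a difference of binomial coefficients; D equals the dimension of the space of n-variable spherical harmonics of degree n). Then there exist real polynomials p_1, …, p_D in the entries of an n×n symmetric matrix, each homogeneous of degree n(n−1)/2, such that the discriminant satisfies δ(A) = p_1(A)² + ⋯ + p_D(A)² for every n×n real symmetric matrix A. -/
open Matrix BigOperators

namespace DiscSOS

/-- Symmetrized Krylov determinants. -/
def G {R : Type*} [CommRing R] {n : ℕ} (A : Matrix (Fin n) (Fin n) R) (i : Fin n → Fin n) : R :=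
  ∑ σ : Equiv.Perm (Fin n), Matrix.det (Matrix.of fun r k : Fin n => (A ^ (k : ℕ)) r (i (σ k)))

/-- Permanent-like sums. -/
def P {n : ℕ} (U : Matrix (Fin n) (Fin n) ℝ) (i : Fin n → Fin n) : ℝ :=
  ∑ σ : Equiv.Perm (Fin n), ∏ k, U (i k) (σ k)

/-- The generic matrix. -/
noncomputable def X (n : ℕ) : Matrix (Fin n) (Fin n) (MvPolynomial (Fin n × Fin n) ℝ) :=
  Matrix.of fun a b => MvPolynomial.X (a, b)

lemma X_pow_hom (n k : ℕ) (a b : Fin n) : ((X n ^ k) a b).IsHomogeneous k := by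
  induction k generalizing a b with
  | zero =>
    rw [pow_zero, Matrix.one_apply]
    split_ifs
    · exact MvPolynomial.isHomogeneous_one _ _
    · exact MvPolynomial.isHomogeneous_zero _ _ _
  | succ k ih =>
    rw [pow_succ, Matrix.mul_apply]
    apply MvPolynomial.IsHomogeneous.sum
    intro j _
    exact (ih a j).mul (MvPolynomial.isHomogeneous_X _ _)

lemma G_hom (n : ℕ) (i : Fin n → Fin n) : (G (X n) i).IsHomogeneous (n * (n - 1) / 2) := by
  unfold G
  apply MvPolynomial.IsHomogeneous.sum
  intro σ _
  rw [Matrix.det_apply']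
  apply MvPolynomial.IsHomogeneous.sum
  intro τ _
  have h1 : (∏ k, (Matrix.of fun r k : Fin n => (X n ^ (k : ℕ)) r (i (σ k))) (τ k) k).IsHomogeneous
      (n * (n - 1) / 2) := by
    rw [← Finset.sum_range_id, ← Fin.sum_univ_eq_sum_range (fun k => k)]
    apply MvPolynomial.IsHomogeneous.prod
    intro k _
    exact X_pow_hom _ _ _ _
  have h2 : (((Equiv.Perm.sign τ : ℤˣ) : ℤ) : MvPolynomial (Fin n × Fin n) ℝ).IsHomogeneous 0 := by
    rcases Int.units_eq_one_or (Equiv.Perm.sign τ) with h | h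
    · rw [h]; simpa using MvPolynomial.isHomogeneous_one (Fin n × Fin n) ℝ
    · rw [h]; simpa using (MvPolynomial.isHomogeneous_one (Fin n × Fin n) ℝ).neg
  simpa using h2.mul h1

lemma G_eval {n : ℕ} (A : Matrix (Fin n) (Fin n) ℝ) (i : Fin n → Fin n) :
    evalMat (G (X n) i) A = G A i := by
  unfold evalMat G
  rw [map_sum]
  refine Finset.sum_congr rfl fun σ _ => ?_
  rw [RingHom.map_det]
  congr 1
  ext r k
  have h : (MvPolynomial.eval (fun ij : Fin n × Fin n => A ij.1 ij.2)).mapMatrix (X n) = A := by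
    ext a b; simp [X]
  have h2 := congrArg (fun M => M r (i (σ k)))
    (map_pow (MvPolynomial.eval (fun ij : Fin n × Fin n => A ij.1 ij.2)).mapMatrix (X n) (k : ℕ))
  simp only [h] at h2
  simpa using h2

lemma P_perm {n : ℕ} (U : Matrix (Fin n) (Fin n) ℝ) (i : Fin n → Fin n) (τ : Equiv.Perm (Fin n)) :
    P U (i ∘ τ) = P U i := by
  unfold P
  rw [← Equiv.sum_comp (Equiv.mulRight τ)]
  refine Finset.sum_congr rfl fun σ _ => ?_
  rw [← Equiv.prod_comp τ (fun k => U (i k) (σ k))]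
  rfl

lemma P_perm' {n : ℕ} (U : Matrix (Fin n) (Fin n) ℝ) (i : Fin n → Fin n) (τ : Equiv.Perm (Fin n)) :
    ∑ σ : Equiv.Perm (Fin n), ∏ k, U (i (σ k)) (τ k) = P U i := by
  unfold P
  conv_rhs => rw [← Equiv.sum_comp ((Equiv.inv _).trans (Equiv.mulLeft τ))]
  refine Finset.sum_congr rfl fun σ _ => ?_
  have := Equiv.prod_comp σ (fun k => U (i k) (τ (σ.symm k)))
  simp only [Equiv.symm_apply_apply] at this
  rw [this]
  rfl

lemma G_eq {n : ℕ} (A U : Matrix (Fin n) (Fin n) ℝ) (l : Fin n → ℝ)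
    (hU : Uᵀ * U = 1) (hA : A = U * diagonal l * Uᵀ) (i : Fin n → Fin n) :
    G A i = U.det * (vandermonde l).det * P U i := by
  have hpow : ∀ k : ℕ, A ^ k = U * diagonal (fun j => l j ^ k) * Uᵀ := by
    intro k
    induction k with
    | zero =>
      simp [_root_.mul_eq_one_comm.mp hU]
    | succ k ih =>
      rw [pow_succ, ih, hA]
      calc U * diagonal (fun j => l j ^ k) * Uᵀ * (U * diagonal l * Uᵀ)
          = U * diagonal (fun j => l j ^ k) * (Uᵀ * U) * diagonal l * Uᵀ := by
            simp only [Matrix.mul_assoc]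
        _ = _ := by
            rw [hU, Matrix.mul_one, Matrix.mul_assoc U, diagonal_mul_diagonal]
            simp only [pow_succ]
  have h1 : ∀ σ : Equiv.Perm (Fin n),
      (Matrix.of fun r k : Fin n => (A ^ (k : ℕ)) r (i (σ k)))
        = U * Matrix.of fun j k : Fin n => l j ^ (k : ℕ) * U (i (σ k)) j := by
    intro σ
    ext r k
    simp only [Matrix.of_apply, hpow]
    rw [Matrix.mul_assoc, Matrix.mul_apply, Matrix.mul_apply]
    simp [Matrix.diagonal_mul]
  unfold G
  simp only [h1, Matrix.det_mul]
  rw [← Finset.mul_sum, mul_assoc]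
  congr 1
  simp only [Matrix.det_apply']
  rw [Finset.sum_comm, Finset.sum_mul]
  refine Finset.sum_congr rfl fun τ _ => ?_
  simp only [Matrix.of_apply, Finset.prod_mul_distrib, vandermonde_apply]
  rw [← P_perm' U i τ, Finset.mul_sum]
  refine Finset.sum_congr rfl fun σ _ => ?_
  ring

lemma sum_P_sq {n : ℕ} (U : Matrix (Fin n) (Fin n) ℝ) (hU : Uᵀ * U = 1) :
    ∑ i : Fin n → Fin n, P U i ^ 2 = (n.factorial : ℝ) := by
  have hU' : ∀ a b, ∑ r, U r a * U r b = if a = b then 1 else 0 := by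
    intro a b
    have := congrArg (fun M => M a b) hU
    simpa [Matrix.mul_apply, Matrix.one_apply] using this
  have h : ∀ σ τ : Equiv.Perm (Fin n),
      ∑ i : Fin n → Fin n, (∏ k, U (i k) (σ k)) * (∏ k, U (i k) (τ k)) = if σ = τ then 1 else 0 := by
    intro σ τ
    simp only [← Finset.prod_mul_distrib]
    have := Finset.prod_univ_sum (fun _ : Fin n => (Finset.univ : Finset (Fin n)))
      (fun k r => U r (σ k) * U r (τ k))
    rw [Fintype.piFinset_univ] at this
    rw [← this]
    simp only [hU']
    rw [Finset.prod_ite_zero]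
    simp [Equiv.ext_iff]
  simp only [P, sq, Finset.sum_mul_sum]
  rw [Finset.sum_comm]
  have : ∀ σ : Equiv.Perm (Fin n), ∑ i : Fin n → Fin n, ∑ τ : Equiv.Perm (Fin n),
      (∏ k, U (i k) (σ k)) * (∏ k, U (i k) (τ k)) = 1 := by
    intro σ
    rw [Finset.sum_comm]
    simp [h]
  simp only [this]
  simp [Fintype.card_perm]

lemma P_trace {m : ℕ} (U : Matrix (Fin (m + 2)) (Fin (m + 2)) ℝ) (hU : Uᵀ * U = 1)
    (t : Fin m → Fin (m + 2)) :
    ∑ a, P U (Fin.cons a (Fin.cons a t : Fin (m + 1) → Fin (m + 2))) = 0 := by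
  have hU' : ∀ a b, ∑ r, U r a * U r b = if a = b then 1 else 0 := by
    intro a b
    have := congrArg (fun M => M a b) hU
    simpa [Matrix.mul_apply, Matrix.one_apply] using this
  unfold P
  rw [Finset.sum_comm]
  refine Finset.sum_eq_zero fun σ _ => ?_
  simp only [Fin.prod_univ_succ, Fin.cons_zero, Fin.cons_succ, ← mul_assoc]
  rw [← Finset.sum_mul, hU', if_neg, zero_mul]
  intro h
  have := σ.injective h
  simp at this

lemma exists_perm {n : ℕ} (f g : Fin n → Fin n)
    (h : (List.ofFn f : Multiset (Fin n)) = List.ofFn g) : ∃ σ : Equiv.Perm (Fin n), f = g ∘ σ := by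
  have h1 : (List.ofFn (f ∘ Tuple.sort f)).Perm (List.ofFn (g ∘ Tuple.sort g)) :=
    ((Equiv.Perm.ofFn_comp_perm _ f).trans (Multiset.coe_eq_coe.mp h)).trans
      (Equiv.Perm.ofFn_comp_perm _ g).symm
  have h2 : f ∘ Tuple.sort f = g ∘ Tuple.sort g :=
    List.ofFn_injective (h1.eq_of_pairwise' (Tuple.monotone_sort f).sortedLE_ofFn.pairwise
      (Tuple.monotone_sort g).sortedLE_ofFn.pairwise)
  refine ⟨(Tuple.sort f).symm.trans (Tuple.sort g), ?_⟩
  funext x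
  have := congrFun h2 ((Tuple.sort f).symm x)
  simpa using this

/-- Symmetric traceless tensors. -/
def S (m : ℕ) : Submodule ℝ (EuclideanSpace ℝ (Fin (m + 2) → Fin (m + 2))) where
  carrier := {T | (∀ (i : Fin (m + 2) → Fin (m + 2)) (σ : Equiv.Perm (Fin (m + 2))), T (i ∘ σ) = T i) ∧
    ∀ t : Fin m → Fin (m + 2),
      ∑ a, T (Fin.cons a (Fin.cons a t : Fin (m + 1) → Fin (m + 2))) = 0}
  add_mem' := by
    rintro A B ⟨h1, h2⟩ ⟨h3, h4⟩
    refine ⟨fun i σ => ?_, fun t => ?_⟩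
    · simp [h1, h3]
    · simp [Finset.sum_add_distrib, h2, h4]
  zero_mem' := by
    refine ⟨fun i σ => ?_, fun t => ?_⟩ <;> simp
  smul_mem' := by
    rintro c A ⟨h1, h2⟩
    refine ⟨fun i σ => ?_, fun t => ?_⟩
    · simp [h1]
    · simp [← Finset.mul_sum, h2]

/-- Multiset of a tuple. -/
def q {n : ℕ} (i : Fin n → Fin n) : Sym (Fin n) n := ⟨(List.ofFn i : Multiset (Fin n)), by simp⟩

lemma exists_tuple {α : Type*} {k : ℕ} (s : Multiset α) (hs : Multiset.card s = k) :
    ∃ t : Fin k → α, s = List.ofFn t := by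
  subst hs
  induction s using Quotient.inductionOn with
  | h l => exact ⟨l.get, by simp⟩

lemma q_surj {n : ℕ} (s : Sym (Fin n) n) : ∃ i, q i = s := by
  obtain ⟨s, hs⟩ := s
  obtain ⟨t, rfl⟩ := exists_tuple s hs
  exact ⟨t, rfl⟩

/-- Adding two zeros. -/
def ins (m : ℕ) (s : Sym (Fin (m + 2)) m) : Sym (Fin (m + 2)) (m + 2) :=
  (0 : Fin (m + 2)) ::ₛ ((0 : Fin (m + 2)) ::ₛ s)

lemma ins_inj (m : ℕ) : Function.Injective (ins m) := by
  intro a b h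
  simpa [ins] using h

lemma S_zero {m : ℕ} (T : EuclideanSpace ℝ (Fin (m + 2) → Fin (m + 2))) (hT : T ∈ S m)
    (h : ∀ i, q i ∉ Set.range (ins m) → T i = 0) : T = 0 := by
  obtain ⟨h1, h2⟩ := hT
  have key : ∀ c : ℕ, ∀ i : Fin (m + 2) → Fin (m + 2), (List.ofFn i).count 0 = c → T i = 0 := by
    intro c
    induction c using Nat.strong_induction_on with
    | _ c ih =>
      intro i hi
      by_cases hq : q i ∈ Set.range (ins m)
      · obtain ⟨⟨s, hs⟩, hsi⟩ := hq
        obtain ⟨t, rfl⟩ := exists_tuple s hs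
        have hm : (List.ofFn i : Multiset (Fin (m + 2)))
            = List.ofFn (Fin.cons 0 (Fin.cons 0 t : Fin (m + 1) → Fin (m + 2)) :
              Fin (m + 2) → Fin (m + 2)) := by
          have := congrArg Subtype.val hsi
          simp only [q, ins] at this
          rw [← this]
          simp only [List.ofFn_succ, Fin.cons_zero, Fin.cons_succ]
          rfl
        obtain ⟨σ, hσ⟩ := exists_perm _ _ hm
        have hcnt := (Multiset.coe_eq_coe.mp hm).count_eq 0
        rw [hi] at hcnt
        have h3 := h2 t
        rw [Finset.sum_eq_single 0] at h3
        · rw [hσ, h1, h3]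
        · intro a _ ha
          refine ih _ ?_ _ rfl
          rw [hcnt]
          simp [List.ofFn_succ, ha]
        · simp
      · exact h i hq
  ext i
  exact key _ i rfl

lemma card_D (m : ℕ) : Fintype.card {s : Sym (Fin (m + 2)) (m + 2) // s ∉ Set.range (ins m)} =
    Nat.choose (2 * (m + 2) - 1) (m + 2 - 1) - Nat.choose (2 * (m + 2) - 3) (m + 2 - 1) := by
  classical
  rw [Fintype.card_subtype_compl]
  have h : Fintype.card {s : Sym (Fin (m + 2)) (m + 2) // s ∈ Set.range (ins m)}
      = Fintype.card (Sym (Fin (m + 2)) m) := by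
    have := Set.card_range_of_injective (ins_inj m)
    convert this
  rw [h, Sym.card_sym_eq_choose, Sym.card_sym_eq_choose, Fintype.card_fin]
  congr 1
  · have : m + 2 + (m + 2) - 1 = 2 * (m + 2) - 1 := by omega
    rw [this]
    apply Nat.choose_symm_of_eq_add; omega
  · have : m + 2 + m - 1 = 2 * (m + 2) - 3 := by omega
    rw [this]
    apply Nat.choose_symm_of_eq_add; omega

lemma finrank_S (m : ℕ) : Module.finrank ℝ (S m) ≤
    Nat.choose (2 * (m + 2) - 1) (m + 2 - 1) - Nat.choose (2 * (m + 2) - 3) (m + 2 - 1) := by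
  classical
  rw [← card_D, ← Module.finrank_fintype_fun_eq_card ℝ]
  choose rep hrep using fun s => q_surj (n := m + 2) s
  let f : S m →ₗ[ℝ] ({s : Sym (Fin (m + 2)) (m + 2) // s ∉ Set.range (ins m)} → ℝ) :=
    { toFun := fun T s => T.1 (rep s.1)
      map_add' := by intro a b; rfl
      map_smul' := by intro a b; rfl }
  apply LinearMap.finrank_le_finrank_of_injective (f := f)
  rw [← LinearMap.ker_eq_bot, LinearMap.ker_eq_bot']
  intro T hT
  apply Subtype.ext
  apply S_zero T.1 T.2
  intro i hi
  have h1 := congrFun hT ⟨q i, hi⟩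
  obtain ⟨σ, hσ⟩ := exists_perm (rep (q i)) i (congrArg Subtype.val (hrep (q i)))
  have h2 : T.1 (rep (q i)) = 0 := h1
  rw [hσ, T.2.1] at h2
  exact h2

lemma exists_frame {E : Type*} [NormedAddCommGroup E] [InnerProductSpace ℝ E]
    [FiniteDimensional ℝ E] (V : Submodule ℝ E) (D : ℕ) (hD : Module.finrank ℝ V ≤ D) :
    ∃ e : Fin D → E, ∀ v ∈ V, ∑ k, (inner ℝ (e k) v : ℝ) ^ 2 = ‖v‖ ^ 2 := by
  let b := stdOrthonormalBasis ℝ V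
  obtain ⟨r, rfl⟩ := Nat.exists_eq_add_of_le hD
  refine ⟨Fin.append (fun k => (b k : E)) (fun _ => 0), fun v hv => ?_⟩
  rw [Fin.sum_univ_add]
  have := b.sum_sq_inner_right ⟨v, hv⟩
  simpa using this

end DiscSOS

open DiscSOS in
theorem discriminant_sum_of_squares_spherical (n : ℕ) (hn : 2 ≤ n) :
    ∃ p : Fin (Nat.choose (2 * n - 1) (n - 1) - Nat.choose (2 * n - 3) (n - 1)) →
        MvPolynomial (Fin n × Fin n) ℝ,
      (∀ i, (p i).IsHomogeneous (n * (n - 1) / 2)) ∧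
      ∀ (A : Matrix (Fin n) (Fin n) ℝ) (hA : A.IsSymm),
        disc A (isHermitian_of_isSymm hA) = ∑ i, (evalMat (p i) A) ^ 2 := by
  obtain ⟨m, rfl⟩ := Nat.exists_eq_add_of_le' hn
  obtain ⟨e, he⟩ := exists_frame (S m) _ (finrank_S m)
  set c : ℝ := (√((m + 2).factorial : ℝ))⁻¹ with hc
  have hc2 : c ^ 2 * ((m + 2).factorial : ℝ) = 1 := by
    rw [hc, inv_pow, Real.sq_sqrt (by positivity)]
    exact inv_mul_cancel₀ (by positivity)
  refine ⟨fun k => ∑ i, MvPolynomial.C (c * e k i) * DiscSOS.G (DiscSOS.X (m + 2)) i, ?_, ?_⟩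
  · intro k
    apply MvPolynomial.IsHomogeneous.sum
    intro i _
    exact (G_hom _ i).C_mul _
  · intro A hA
    set hH := isHermitian_of_isSymm hA
    set U : Matrix (Fin (m + 2)) (Fin (m + 2)) ℝ := hH.eigenvectorUnitary.1 with hUdef
    have hU : Uᵀ * U = 1 := by
      have := Unitary.star_mul_self_of_mem hH.eigenvectorUnitary.2
      rwa [Matrix.star_eq_conjTranspose, Matrix.conjTranspose_eq_transpose_of_trivial] at this
    have hAU : A = U * diagonal hH.eigenvalues * Uᵀ := by
      have := hH.spectral_theorem
      rw [Unitary.conjStarAlgAut_apply, Matrix.star_eq_conjTranspose,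
        Matrix.conjTranspose_eq_transpose_of_trivial] at this
      exact this
    have hG := G_eq A U hH.eigenvalues hU hAU
    set d := U.det * (vandermonde hH.eigenvalues).det with hd
    have hd2 : d ^ 2 = disc A hH := by
      have h1 : U.det ^ 2 = 1 := by
        have := congrArg Matrix.det hU
        rw [Matrix.det_mul, Matrix.det_transpose, Matrix.det_one] at this
        rw [sq, this]
      rw [hd, mul_pow, h1, one_mul, det_vandermonde, disc, ← Finset.prod_pow]
      refine Finset.prod_congr rfl fun i _ => ?_
      rw [← Finset.prod_pow]
      refine Finset.prod_congr rfl fun j _ => ?_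
      ring
    let v : EuclideanSpace ℝ (Fin (m + 2) → Fin (m + 2)) := WithLp.toLp 2 (fun i => c * d * P U i)
    have hv : v ∈ S m := by
      refine ⟨fun i σ => ?_, fun t => ?_⟩
      · simp only [v, P_perm]
      · simp only [v]
        rw [← Finset.mul_sum, P_trace U hU, mul_zero]
    have hnorm : ‖v‖ ^ 2 = disc A hH := by
      rw [EuclideanSpace.norm_sq_eq]
      simp only [v, Real.norm_eq_abs, sq_abs, mul_pow]
      rw [← Finset.mul_sum, sum_P_sq U hU, ← hd2]
      linear_combination d ^ 2 * hc2
    rw [← hnorm, ← he v hv]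
    refine Finset.sum_congr rfl fun k _ => ?_
    congr 1
    have : evalMat (∑ i, MvPolynomial.C (c * e k i) * DiscSOS.G (DiscSOS.X (m + 2)) i) A
        = ∑ i, (c * e k i) * evalMat (DiscSOS.G (DiscSOS.X (m + 2)) i) A := by
      simp [evalMat, map_sum]
    rw [this, PiLp.inner_apply]
    refine Finset.sum_congr rfl fun i _ => ?_
    rw [G_eval, hG]
    simp [v]
    ring
end

section
/- For n = 3, the vector space of polynomial functions on N that are homogeneous of degree 3 and vanish identically on F has dimension 7, and it coincides with the linear span of the functions A ↦ ξ(A ∧ H_2(A)) as ξ ranges over all linear forms on ⋀² N. -/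
open Matrix BigOperators

/-- `H_2(A) = A² - (Tr(A²)/3)·I` as a trace-zero symmetric matrix. -/
noncomputable def H2 (A : ↥(symTraceless 3)) : ↥(symTraceless 3) :=
  ⟨A.1 ^ 2 - ((A.1 ^ 2).trace / 3) • 1, by
    obtain ⟨h1, h2⟩ := mem_symTraceless.mp A.2
    refine mem_symTraceless.mpr ⟨?_, ?_⟩
    · rw [Matrix.IsSymm, Matrix.transpose_sub, Matrix.transpose_smul, Matrix.transpose_one,
        Matrix.transpose_pow, h1]
    · rw [Matrix.trace_sub, Matrix.trace_smul, Matrix.trace_one]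
      simp only [Fintype.card_fin, smul_eq_mul]
      push_cast
      ring⟩

/-- The wedge product `A ∧ B` in `⋀² N`. -/
noncomputable def wedge2 (A B : ↥(symTraceless 3)) : ↥(⋀[ℝ]^2 ↥(symTraceless 3)) :=
  ⟨ExteriorAlgebra.ιMulti ℝ 2 ![A, B], ExteriorAlgebra.ιMulti_range ℝ 2 ⟨![A, B], rfl⟩⟩

/-- The space of polynomial functions on `N` (for `n = 3`) that are homogeneous of degree 3
and vanish on the set of degenerate matrices. -/
noncomputable def idealF3 : Submodule ℝ (↥(symTraceless 3) → ℝ) where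
  carrier := {f | (∃ p : MvPolynomial (Fin 3 × Fin 3) ℝ, p.IsHomogeneous 3 ∧
      ∀ A : ↥(symTraceless 3), f A = evalMat p A.1) ∧
    ∀ A : ↥(symTraceless 3), Degen A → f A = 0}
  add_mem' := by
    rintro f g ⟨⟨p, hp, hfp⟩, hf⟩ ⟨⟨q, hq, hgq⟩, hg⟩
    refine ⟨⟨p + q, hp.add hq, fun A => ?_⟩, fun A hA => ?_⟩
    · simp only [Pi.add_apply, evalMat, map_add, hfp A, hgq A]
    · simp only [Pi.add_apply, hf A hA, hg A hA, add_zero]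
  zero_mem' := by
    refine ⟨⟨0, MvPolynomial.isHomogeneous_zero _ _ _, fun A => ?_⟩, fun A _ => rfl⟩
    simp [evalMat]
  smul_mem' := by
    rintro c f ⟨⟨p, hp, hfp⟩, hf⟩
    refine ⟨⟨c • p, by rw [MvPolynomial.smul_eq_C_mul]; exact hp.C_mul c, fun A => ?_⟩,
      fun A hA => ?_⟩
    · simp only [Pi.smul_apply, evalMat, MvPolynomial.smul_eval, hfp A, smul_eq_mul]
    · simp only [Pi.smul_apply, hf A hA, smul_zero]


theorem degen_of_quad (A : symTraceless 3) (l m : ℝ)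
    (h : (A.1 - l • 1) * (A.1 - m • 1) = 0) : Degen A := by
  have hA := isHermitian_of_isSymm (mem_symTraceless.mp A.2).1
  have key : ∀ i, eigsN A i = l ∨ eigsN A i = m := by
    intro i
    have hv := hA.mulVec_eigenvectorBasis i
    have hne : (⇑(hA.eigenvectorBasis i) : Fin 3 → ℝ) ≠ 0 := by
      intro h0
      apply hA.eigenvectorBasis.toBasis.ne_zero i
      ext j
      simpa using congrFun h0 j
    have h2 := congrArg (fun M => M *ᵥ (⇑(hA.eigenvectorBasis i) : Fin 3 → ℝ)) h
    simp only [← Matrix.mulVec_mulVec, Matrix.sub_mulVec, Matrix.smul_mulVec, Matrix.one_mulVec, hv,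
      Matrix.zero_mulVec, ← sub_smul, Matrix.mulVec_smul, smul_smul] at h2
    have h3 := (smul_eq_zero.mp h2).resolve_right hne
    change hA.eigenvalues i = l ∨ hA.eigenvalues i = m
    rcases mul_eq_zero.mp h3 with h | h
    · right; linarith
    · left; linarith
  unfold Degen
  rcases key 0 with h0 | h0 <;> rcases key 1 with h1 | h1 <;> rcases key 2 with h2 | h2
  · exact ⟨0, 1, by decide, by rw [h0, h1]⟩
  · exact ⟨0, 1, by decide, by rw [h0, h1]⟩
  · exact ⟨0, 2, by decide, by rw [h0, h2]⟩
  · exact ⟨1, 2, by decide, by rw [h1, h2]⟩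
  · exact ⟨1, 2, by decide, by rw [h1, h2]⟩
  · exact ⟨0, 2, by decide, by rw [h0, h2]⟩
  · exact ⟨0, 1, by decide, by rw [h0, h1]⟩
  · exact ⟨0, 1, by decide, by rw [h0, h1]⟩

theorem quad_of_degen (A : symTraceless 3) (h : Degen A) :
    ∃ l : ℝ, (A.1 - l • 1) * (A.1 - (-2*l) • 1) = 0 := by
  have hA := isHermitian_of_isSymm (mem_symTraceless.mp A.2).1
  have htr : A.1.trace = 0 := (mem_symTraceless.mp A.2).2
  have hs := hA.trace_eq_sum_eigenvalues
  rw [htr, Fin.sum_univ_three] at hs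
  simp only [RCLike.ofReal_real_eq_id, id] at hs
  have : ∃ l : ℝ, ∀ i, (hA.eigenvalues i - l) * (hA.eigenvalues i - (-2*l)) = 0 := by
    obtain ⟨i, j, hij, he⟩ := h
    change hA.eigenvalues i = hA.eigenvalues j at he
    refine ⟨hA.eigenvalues i, ?_⟩
    intro k
    fin_cases i <;> fin_cases j <;> first | exact absurd rfl hij | skip
    all_goals
      fin_cases k <;> simp at he hs ⊢ <;> first | (left; linarith) | (right; linarith)
  obtain ⟨l, hl⟩ := this
  refine ⟨l, ?_⟩
  apply (Matrix.toLin' (R := ℝ)).injective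
  apply (hA.eigenvectorBasis.toBasis.map (WithLp.linearEquiv 2 ℝ (Fin 3 → ℝ))).ext
  intro i
  have hv := hA.mulVec_eigenvectorBasis i
  simp only [Module.Basis.map_apply, OrthonormalBasis.coe_toBasis, WithLp.linearEquiv_apply, map_zero, LinearMap.zero_apply, Matrix.toLin'_apply]
  change _ *ᵥ (⇑(hA.eigenvectorBasis i) : Fin 3 → ℝ) = 0
  simp only [← Matrix.mulVec_mulVec, Matrix.sub_mulVec, Matrix.smul_mulVec, Matrix.one_mulVec, hv,
      Matrix.zero_mulVec, ← sub_smul, Matrix.mulVec_smul, smul_smul]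
  rw [mul_comm, hl i, zero_smul]

theorem H2_of_degen (A : symTraceless 3) (h : Degen A) : ∃ l : ℝ, H2 A = l • A := by
  obtain ⟨l, hl⟩ := quad_of_degen A h
  have htr : A.1.trace = 0 := (mem_symTraceless.mp A.2).2
  have h2 : A.1 ^ 2 = (-l) • A.1 + (2 * l^2) • 1 := by
    have : A.1 ^ 2 - ((-l) • A.1 + (2 * l^2) • 1) = (A.1 - l • 1) * (A.1 - (-2*l) • 1) := by
      simp only [sub_mul, mul_sub, pow_two, smul_mul_assoc, mul_smul_comm, one_mul, mul_one, smul_smul]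
      module
    rw [hl] at this
    exact sub_eq_zero.mp this
  refine ⟨-l, Subtype.ext ?_⟩
  change A.1 ^ 2 - ((A.1 ^ 2).trace / 3) • 1 = (-l) • A.1
  rw [h2, Matrix.trace_add, Matrix.trace_smul, Matrix.trace_smul, htr, Matrix.trace_one]
  simp

theorem wedge_vanish (ξ : Module.Dual ℝ ↥(⋀[ℝ]^2 ↥(symTraceless 3))) (A : symTraceless 3)
    (h : Degen A) : ξ (wedge2 A (H2 A)) = 0 := by
  obtain ⟨l, hl⟩ := H2_of_degen A h
  have : wedge2 A (H2 A) = 0 := by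
    apply Subtype.ext
    change ExteriorAlgebra.ιMulti ℝ 2 ![A, H2 A] = 0
    rw [hl, ExteriorAlgebra.ιMulti_apply]
    simp
  rw [this, map_zero]

theorem wedge_poly (ξ : Module.Dual ℝ ↥(⋀[ℝ]^2 ↥(symTraceless 3))) :
    ∃ p : MvPolynomial (Fin 3 × Fin 3) ℝ, p.IsHomogeneous 3 ∧
      ∀ A : ↥(symTraceless 3), ξ (wedge2 A (H2 A)) = evalMat p A.1 := by
  obtain ⟨P, hP⟩ := (symTraceless 3).subtype.exists_leftInverse_of_injective (by simp)
  have hP' : ∀ A : symTraceless 3, P A.1 = A := fun A => LinearMap.congr_fun hP A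
  let B : symTraceless 3 → symTraceless 3 → ℝ := fun A C => ξ (wedge2 A C)
  have hB : ∀ A C, B A C = ξ (exteriorPower.ιMulti ℝ 2 ![A, C]) := fun A C => rfl
  have u0 : ∀ a b c : symTraceless 3, Function.update ![a, c] 0 b = ![b, c] := by
    intro a b c; ext i; fin_cases i <;> simp
  have u1 : ∀ a b c : symTraceless 3, Function.update ![a, c] 1 b = ![a, b] := by
    intro a b c; ext i; fin_cases i <;> simp
  let B' : symTraceless 3 →ₗ[ℝ] symTraceless 3 →ₗ[ℝ] ℝ := LinearMap.mk₂ ℝ B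
    (by
      intro a b c
      have := (ξ.compAlternatingMap (exteriorPower.ιMulti ℝ 2)).map_update_add ![a, c] 0 a b
      simp only [u0, u1] at this; exact this)
    (by
      intro r a c
      have := (ξ.compAlternatingMap (exteriorPower.ιMulti ℝ 2)).map_update_smul ![a, c] 0 r a
      simp only [u0, u1] at this; exact this)
    (by
      intro a b c
      have := (ξ.compAlternatingMap (exteriorPower.ιMulti ℝ 2)).map_update_add ![a, c] 1 b c
      simp only [u0, u1] at this; exact this)
    (by
      intro r a c
      have := (ξ.compAlternatingMap (exteriorPower.ιMulti ℝ 2)).map_update_smul ![a, c] 1 r c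
      simp only [u0, u1] at this; exact this)
  have hexp : ∀ M : Matrix (Fin 3) (Fin 3) ℝ, P M = ∑ i, ∑ j, M i j • P (Matrix.single i j 1) := by
    intro M
    conv_lhs => rw [Matrix.matrix_eq_sum_single M]
    simp only [map_sum]
    refine Finset.sum_congr rfl fun i _ => Finset.sum_congr rfl fun j _ => ?_
    rw [← map_smul, Matrix.smul_single, smul_eq_mul, mul_one]
  let h2 : Fin 3 → Fin 3 → MvPolynomial (Fin 3 × Fin 3) ℝ := fun k l =>
    (∑ m, MvPolynomial.X (k, m) * MvPolynomial.X (m, l)) -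
      MvPolynomial.C ((1 : Matrix (Fin 3) (Fin 3) ℝ) k l / 3) *
        ∑ m, ∑ n, MvPolynomial.X (m, n) * MvPolynomial.X (n, m)
  have hXX : ∀ a b : Fin 3 × Fin 3, (MvPolynomial.X a * MvPolynomial.X b : MvPolynomial _ ℝ).IsHomogeneous 2 :=
    fun a b => (MvPolynomial.isHomogeneous_X ℝ a).mul (MvPolynomial.isHomogeneous_X ℝ b)
  have hh2 : ∀ k l, (h2 k l).IsHomogeneous 2 := by
    intro k l
    refine MvPolynomial.IsHomogeneous.sub ?_ (MvPolynomial.IsHomogeneous.C_mul ?_ _)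
    · exact MvPolynomial.IsHomogeneous.sum _ _ _ fun m _ => hXX _ _
    · exact MvPolynomial.IsHomogeneous.sum _ _ _ fun m _ =>
        MvPolynomial.IsHomogeneous.sum _ _ _ fun n _ => hXX _ _
  have hev : ∀ (A : symTraceless 3) k l, (H2 A).1 k l = evalMat (h2 k l) A.1 := by
    intro A k l
    simp only [H2, h2, evalMat, map_sub, map_sum, map_mul, MvPolynomial.eval_X, MvPolynomial.eval_C,
      Matrix.sub_apply, Matrix.smul_apply, pow_two, Matrix.mul_apply, Matrix.trace, Matrix.diag,
      smul_eq_mul]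
    ring
  refine ⟨∑ k, ∑ l, ∑ i, ∑ j, MvPolynomial.C (B' (P (Matrix.single i j 1)) (P (Matrix.single k l 1))) *
    (MvPolynomial.X (i, j) * h2 k l), ?_, ?_⟩
  · refine MvPolynomial.IsHomogeneous.sum _ _ _ fun k _ => MvPolynomial.IsHomogeneous.sum _ _ _ fun l _ =>
      MvPolynomial.IsHomogeneous.sum _ _ _ fun i _ => MvPolynomial.IsHomogeneous.sum _ _ _ fun j _ => ?_
    exact ((MvPolynomial.isHomogeneous_X ℝ (i, j)).mul (hh2 k l)).C_mul _
  · intro A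
    change B' A (H2 A) = _
    have e1 := hexp A.1
    have e2 := hexp (H2 A).1
    rw [hP'] at e1 e2
    have e3 := congrArg₂ (fun a b => B' a b) e1 e2
    refine e3.trans ?_
    simp only [map_sum, map_smul, LinearMap.sum_apply, LinearMap.smul_apply, smul_eq_mul, hev]
    simp only [evalMat, map_sum, map_mul, MvPolynomial.eval_X, MvPolynomial.eval_C]
    simp only [Finset.mul_sum]
    refine Finset.sum_congr rfl fun i _ => Finset.sum_congr rfl fun j _ =>
      ?_
    refine Finset.sum_congr rfl fun k _ => Finset.sum_congr rfl fun l _ => ?_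
    ring

def P35 (c : Fin 35 → ℝ) (p q x y z : ℝ) : ℝ :=
  c 0 * (p*p*p) +
  c 1 * (p*p*q) +
  c 2 * (p*p*x) +
  c 3 * (p*p*y) +
  c 4 * (p*p*z) +
  c 5 * (p*q*q) +
  c 6 * (p*q*x) +
  c 7 * (p*q*y) +
  c 8 * (p*q*z) +
  c 9 * (p*x*x) +
  c 10 * (p*x*y) +
  c 11 * (p*x*z) +
  c 12 * (p*y*y) +
  c 13 * (p*y*z) +
  c 14 * (p*z*z) +
  c 15 * (q*q*q) +
  c 16 * (q*q*x) +
  c 17 * (q*q*y) +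
  c 18 * (q*q*z) +
  c 19 * (q*x*x) +
  c 20 * (q*x*y) +
  c 21 * (q*x*z) +
  c 22 * (q*y*y) +
  c 23 * (q*y*z) +
  c 24 * (q*z*z) +
  c 25 * (x*x*x) +
  c 26 * (x*x*y) +
  c 27 * (x*x*z) +
  c 28 * (x*y*y) +
  c 29 * (x*y*z) +
  c 30 * (x*z*z) +
  c 31 * (y*y*y) +
  c 32 * (y*y*z) +
  c 33 * (y*z*z) +
  c 34 * (z*z*z)

def gp (p q x y z : ℝ) : Fin 7 → ℝ :=
  ![p*q*q + (-1)*(p*p*q) + p*x*x + (-1)*(p*y*y) + (-1)*(q*x*x) + q*z*z,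
    p*y*z + p*q*x + (-1)*(x*x*x) + x*z*z,
    q*y*z + p*q*x + (-1)*(x*x*x) + x*y*y,
    p*x*z + (-1)*(x*x*y) + y*z*z,
    q*x*z + p*q*y + (-1)*(q*q*y) + (-1)*(x*x*y) + y*y*y,
    p*x*y + p*q*z + (-1)*(p*p*z) + (-1)*(x*x*z) + z*z*z,
    q*x*y + (-1)*(x*x*z) + y*y*z]

def gc (c : Fin 35 → ℝ) : Fin 7 → ℝ :=
  ![c 9, c 13, c 23, c 11, c 21, c 10, c 20]

set_option maxHeartbeats 4000000 in
theorem core (c : Fin 35 → ℝ)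
    (h : ∀ r s t : ℝ, P35 c (r^2-t^2) (s^2-t^2) (r*s) (r*t) (s*t) = 0) (p q x y z : ℝ) :
    P35 c p q x y z = ∑ i, gc c i * gp p q x y z i := by
  have e0 : (-1) * c 0 + (-1) * c 1 + (-1) * c 5 + (-1) * c 15 = 0 := by
    have := h (0) (0) (1)
    simp only [P35] at this
    linear_combination this
  have e1 : (1) * c 15 = 0 := by
    have := h (0) (1) (0)
    simp only [P35] at this
    linear_combination this
  have e2 : (1) * c 0 = 0 := by
    have := h (1) (0) (0)
    simp only [P35] at this
    linear_combination this
  have e3 : (-1) * c 0 + (-1) * c 4 + (-1) * c 14 + (-1) * c 34 = 0 := by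
    have := h (0) (1) (-1)
    simp only [P35] at this
    linear_combination this
  have e4 : (-1) * c 0 + (1) * c 4 + (-1) * c 14 + (1) * c 34 = 0 := by
    have := h (0) (1) (1)
    simp only [P35] at this
    linear_combination this
  have e5 : (1) * c 0 + (1) * c 1 + (-1) * c 2 + (1) * c 5 + (-1) * c 6 + (1) * c 9 + (1) * c 15 + (-1) * c 16 + (1) * c 19 + (-1) * c 25 = 0 := by
    have := h (1) (-1) (0)
    simp only [P35] at this
    linear_combination this
  have e6 : (-1) * c 15 + (-1) * c 17 + (-1) * c 22 + (-1) * c 31 = 0 := by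
    have := h (1) (0) (-1)
    simp only [P35] at this
    linear_combination this
  have e7 : (-1) * c 15 + (1) * c 17 + (-1) * c 22 + (1) * c 31 = 0 := by
    have := h (1) (0) (1)
    simp only [P35] at this
    linear_combination this
  have e8 : (1) * c 0 + (1) * c 1 + (1) * c 2 + (1) * c 5 + (1) * c 6 + (1) * c 9 + (1) * c 15 + (1) * c 16 + (1) * c 19 + (1) * c 25 = 0 := by
    have := h (1) (1) (0)
    simp only [P35] at this
    linear_combination this
  have e9 : (-1) * c 25 + (-1) * c 26 + (1) * c 27 + (-1) * c 28 + (1) * c 29 + (-1) * c 30 + (-1) * c 31 + (1) * c 32 + (-1) * c 33 + (1) * c 34 = 0 := by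
    have := h (1) (-1) (-1)
    simp only [P35] at this
    linear_combination this
  have e10 : (-1) * c 25 + (1) * c 26 + (-1) * c 27 + (-1) * c 28 + (1) * c 29 + (-1) * c 30 + (1) * c 31 + (-1) * c 32 + (1) * c 33 + (-1) * c 34 = 0 := by
    have := h (1) (-1) (1)
    simp only [P35] at this
    linear_combination this
  have e11 : (1) * c 25 + (-1) * c 26 + (-1) * c 27 + (1) * c 28 + (1) * c 29 + (1) * c 30 + (-1) * c 31 + (-1) * c 32 + (-1) * c 33 + (-1) * c 34 = 0 := by
    have := h (1) (1) (-1)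
    simp only [P35] at this
    linear_combination this
  have e12 : (1) * c 25 + (1) * c 26 + (1) * c 27 + (1) * c 28 + (1) * c 29 + (1) * c 30 + (1) * c 31 + (1) * c 32 + (1) * c 33 + (1) * c 34 = 0 := by
    have := h (1) (1) (1)
    simp only [P35] at this
    linear_combination this
  have e13 : (-64) * c 0 + (-48) * c 1 + (-32) * c 4 + (-36) * c 5 + (-24) * c 8 + (-16) * c 14 + (-27) * c 15 + (-18) * c 18 + (-12) * c 24 + (-8) * c 34 = 0 := by
    have := h (0) (1) (-2)
    simp only [P35] at this
    linear_combination this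
  have e14 : (-64) * c 0 + (-48) * c 1 + (32) * c 4 + (-36) * c 5 + (24) * c 8 + (-16) * c 14 + (-27) * c 15 + (18) * c 18 + (-12) * c 24 + (8) * c 34 = 0 := by
    have := h (0) (1) (2)
    simp only [P35] at this
    linear_combination this
  have e15 : (-1) * c 0 + (3) * c 1 + (-2) * c 4 + (-9) * c 5 + (6) * c 8 + (-4) * c 14 + (27) * c 15 + (-18) * c 18 + (12) * c 24 + (-8) * c 34 = 0 := by
    have := h (0) (2) (-1)
    simp only [P35] at this
    linear_combination this
  have e16 : (1) * c 0 + (4) * c 1 + (-2) * c 2 + (16) * c 5 + (-8) * c 6 + (4) * c 9 + (64) * c 15 + (-32) * c 16 + (16) * c 19 + (-8) * c 25 = 0 := by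
    have := h (1) (-2) (0)
    simp only [P35] at this
    linear_combination this
  have e17 : (-27) * c 0 + (-36) * c 1 + (-18) * c 3 + (-48) * c 5 + (-24) * c 7 + (-12) * c 12 + (-64) * c 15 + (-32) * c 17 + (-16) * c 22 + (-8) * c 31 = 0 := by
    have := h (1) (0) (-2)
    simp only [P35] at this
    linear_combination this
  have e18 : (-27) * c 0 + (-36) * c 1 + (18) * c 3 + (-48) * c 5 + (24) * c 7 + (-12) * c 12 + (-64) * c 15 + (32) * c 17 + (-16) * c 22 + (8) * c 31 = 0 := by
    have := h (1) (0) (2)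
    simp only [P35] at this
    linear_combination this
  have e19 : (1) * c 0 + (4) * c 1 + (2) * c 2 + (16) * c 5 + (8) * c 6 + (4) * c 9 + (64) * c 15 + (32) * c 16 + (16) * c 19 + (8) * c 25 = 0 := by
    have := h (1) (2) (0)
    simp only [P35] at this
    linear_combination this
  have e20 : (64) * c 0 + (16) * c 1 + (-32) * c 2 + (4) * c 5 + (-8) * c 6 + (16) * c 9 + (1) * c 15 + (-2) * c 16 + (4) * c 19 + (-8) * c 25 = 0 := by
    have := h (2) (-1) (0)
    simp only [P35] at this
    linear_combination this
  have e21 : (27) * c 0 + (-9) * c 1 + (-18) * c 3 + (3) * c 5 + (6) * c 7 + (12) * c 12 + (-1) * c 15 + (-2) * c 17 + (-4) * c 22 + (-8) * c 31 = 0 := by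
    have := h (2) (0) (-1)
    simp only [P35] at this
    linear_combination this
  have e22 : (27) * c 15 + (-18) * c 16 + (-9) * c 17 + (18) * c 18 + (12) * c 19 + (6) * c 20 + (-12) * c 21 + (3) * c 22 + (-6) * c 23 + (12) * c 24 + (-8) * c 25 + (-4) * c 26 + (8) * c 27 + (-2) * c 28 + (4) * c 29 + (-8) * c 30 + (-1) * c 31 + (2) * c 32 + (-4) * c 33 + (8) * c 34 = 0 := by
    have := h (1) (-2) (-1)
    simp only [P35] at this
    linear_combination this
  have e23 : (27) * c 15 + (-18) * c 16 + (9) * c 17 + (-18) * c 18 + (12) * c 19 + (-6) * c 20 + (12) * c 21 + (3) * c 22 + (-6) * c 23 + (12) * c 24 + (-8) * c 25 + (4) * c 26 + (-8) * c 27 + (-2) * c 28 + (4) * c 29 + (-8) * c 30 + (1) * c 31 + (-2) * c 32 + (4) * c 33 + (-8) * c 34 = 0 := by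
    have := h (1) (-2) (1)
    simp only [P35] at this
    linear_combination this
  have e24 : (-27) * c 0 + (-27) * c 1 + (-9) * c 2 + (-18) * c 3 + (18) * c 4 + (-27) * c 5 + (-9) * c 6 + (-18) * c 7 + (18) * c 8 + (-3) * c 9 + (-6) * c 10 + (6) * c 11 + (-12) * c 12 + (12) * c 13 + (-12) * c 14 + (-27) * c 15 + (-9) * c 16 + (-18) * c 17 + (18) * c 18 + (-3) * c 19 + (-6) * c 20 + (6) * c 21 + (-12) * c 22 + (12) * c 23 + (-12) * c 24 + (-1) * c 25 + (-2) * c 26 + (2) * c 27 + (-4) * c 28 + (4) * c 29 + (-4) * c 30 + (-8) * c 31 + (8) * c 32 + (-8) * c 33 + (8) * c 34 = 0 := by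
    have := h (1) (-1) (-2)
    simp only [P35] at this
    linear_combination this
  have e25 : (-27) * c 0 + (-27) * c 1 + (-9) * c 2 + (18) * c 3 + (-18) * c 4 + (-27) * c 5 + (-9) * c 6 + (18) * c 7 + (-18) * c 8 + (-3) * c 9 + (6) * c 10 + (-6) * c 11 + (-12) * c 12 + (12) * c 13 + (-12) * c 14 + (-27) * c 15 + (-9) * c 16 + (18) * c 17 + (-18) * c 18 + (-3) * c 19 + (6) * c 20 + (-6) * c 21 + (-12) * c 22 + (12) * c 23 + (-12) * c 24 + (-1) * c 25 + (2) * c 26 + (-2) * c 27 + (-4) * c 28 + (4) * c 29 + (-4) * c 30 + (8) * c 31 + (-8) * c 32 + (8) * c 33 + (-8) * c 34 = 0 := by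
    have := h (1) (-1) (2)
    simp only [P35] at this
    linear_combination this
  have e26 : (-27) * c 0 + (-27) * c 1 + (9) * c 2 + (-18) * c 3 + (-18) * c 4 + (-27) * c 5 + (9) * c 6 + (-18) * c 7 + (-18) * c 8 + (-3) * c 9 + (6) * c 10 + (6) * c 11 + (-12) * c 12 + (-12) * c 13 + (-12) * c 14 + (-27) * c 15 + (9) * c 16 + (-18) * c 17 + (-18) * c 18 + (-3) * c 19 + (6) * c 20 + (6) * c 21 + (-12) * c 22 + (-12) * c 23 + (-12) * c 24 + (1) * c 25 + (-2) * c 26 + (-2) * c 27 + (4) * c 28 + (4) * c 29 + (4) * c 30 + (-8) * c 31 + (-8) * c 32 + (-8) * c 33 + (-8) * c 34 = 0 := by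
    have := h (1) (1) (-2)
    simp only [P35] at this
    linear_combination this
  have e27 : (27) * c 15 + (18) * c 16 + (-9) * c 17 + (-18) * c 18 + (12) * c 19 + (-6) * c 20 + (-12) * c 21 + (3) * c 22 + (6) * c 23 + (12) * c 24 + (8) * c 25 + (-4) * c 26 + (-8) * c 27 + (2) * c 28 + (4) * c 29 + (8) * c 30 + (-1) * c 31 + (-2) * c 32 + (-4) * c 33 + (-8) * c 34 = 0 := by
    have := h (1) (2) (-1)
    simp only [P35] at this
    linear_combination this
  have k0 : c 0 = 0 := by
    linear_combination (1) * e2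
  have k1 : c 1 = (-1) * c 9 := by
    linear_combination (4) * e1 + (-5/4) * e2 + (2/3) * e5 + (2/3) * e8 + (-1/24) * e16 + (-1/24) * e19
  have k2 : c 2 = 0 := by
    linear_combination (2) * e1 + (2) * e2 + (2/3) * e5 + (2/9) * e8 + (-1/36) * e16 + (-1/60) * e19 + (-2/45) * e20
  have k3 : c 3 = 0 := by
    linear_combination (2) * e0 + (2) * e2 + (2/3) * e6 + (2/9) * e7 + (-1/36) * e17 + (-1/60) * e18 + (-2/45) * e21
  have k4 : c 4 = (-1) * c 10 := by
    linear_combination (19/2) * e0 + (19/2) * e1 + (-1) * e2 + (3/2) * e3 + (-1/6) * e4 + (7/12) * e5 + (7/12) * e6 + (7/12) * e7 + (7/12) * e8 + (1/12) * e9 + (-3/4) * e10 + (-3/4) * e11 + (1/12) * e12 + (-1/6) * e13 + (-1/6) * e15 + (-1/12) * e16 + (-1/12) * e17 + (-1/12) * e18 + (-1/12) * e19 + (1/12) * e23 + (1/12) * e25 + (1/12) * e26 + (1/12) * e27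
  have k5 : c 5 = (1) * c 9 := by
    linear_combination (-1) * e0 + (-5) * e1 + (1/4) * e2 + (-2/3) * e5 + (-2/3) * e8 + (1/24) * e16 + (1/24) * e19
  have k6 : c 6 = (1) * c 13 + (1) * c 23 := by
    linear_combination (-5) * e0 + (-9/4) * e1 + (-9/4) * e2 + (-1/6) * e3 + (-1/6) * e4 + (-5/4) * e5 + (-1/6) * e6 + (-1/6) * e7 + (-1/9) * e8 + (1/6) * e9 + (1/6) * e10 + (1/24) * e13 + (1/24) * e14 + (1/18) * e16 + (1/24) * e17 + (1/24) * e18 + (1/18) * e20 + (-1/24) * e24 + (-1/24) * e25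
  have k7 : c 7 = (1) * c 21 := by
    linear_combination (-11/2) * e0 + (5/4) * e1 + (-7/4) * e2 + (-2/3) * e3 + (-2/3) * e4 + (1/6) * e5 + (-1/12) * e6 + (-1/3) * e7 + (1/6) * e8 + (-1/6) * e9 + (-1/6) * e11 + (1/24) * e13 + (1/24) * e14 + (-1/24) * e16 + (1/30) * e18 + (-1/24) * e19 + (1/30) * e21 + (1/24) * e22 + (1/24) * e27
  have k8 : c 8 = (1) * c 10 := by
    linear_combination (-11) * e0 + (-11) * e1 + (1) * e2 + (-11/6) * e3 + (-1/6) * e4 + (-7/12) * e5 + (-7/12) * e6 + (-7/12) * e7 + (-7/12) * e8 + (-1/12) * e9 + (3/4) * e10 + (3/4) * e11 + (-1/12) * e12 + (1/6) * e13 + (1/30) * e14 + (1/5) * e15 + (1/12) * e16 + (1/12) * e17 + (1/12) * e18 + (1/12) * e19 + (-1/12) * e23 + (-1/12) * e25 + (-1/12) * e26 + (-1/12) * e27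
  have k12 : c 12 = (-1) * c 9 := by
    linear_combination (4) * e0 + (4) * e1 + (1/2) * e2 + (2/3) * e5 + (2/3) * e6 + (2/3) * e7 + (2/3) * e8 + (-1/24) * e16 + (-1/24) * e17 + (-1/24) * e18 + (-1/24) * e19
  have k14 : c 14 = 0 := by
    linear_combination (-1) * e2 + (-1/2) * e3 + (-1/2) * e4
  have k15 : c 15 = 0 := by
    linear_combination (1) * e1
  have k16 : c 16 = 0 := by
    linear_combination (1/2) * e1 + (1/2) * e2 + (1/3) * e5 + (-1/9) * e8 + (-1/36) * e16 + (1/60) * e19 + (-1/90) * e20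
  have k17 : c 17 = (-1) * c 21 := by
    linear_combination (4) * e0 + (-5/4) * e1 + (1/4) * e2 + (2/3) * e3 + (2/3) * e4 + (-1/6) * e5 + (-1/4) * e6 + (-1/6) * e8 + (1/6) * e9 + (1/6) * e11 + (-1/24) * e13 + (-1/24) * e14 + (1/24) * e16 + (1/24) * e19 + (-1/24) * e22 + (-1/24) * e27
  have k18 : c 18 = 0 := by
    linear_combination (2) * e0 + (2) * e1 + (2/3) * e3 + (2/9) * e4 + (-1/36) * e13 + (-1/60) * e14 + (-2/45) * e15
  have k19 : c 19 = (-1) * c 9 := by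
    linear_combination (1) * e0 + (1/2) * e5 + (1/2) * e8
  have k22 : c 22 = 0 := by
    linear_combination (-1) * e1 + (-1/2) * e6 + (-1/2) * e7
  have k24 : c 24 = (1) * c 9 := by
    linear_combination (3) * e0 + (-13/4) * e1 + (1/4) * e2 + (2/3) * e3 + (2/3) * e4 + (-2/3) * e5 + (-2/3) * e8 + (-1/24) * e13 + (-1/24) * e14 + (1/24) * e16 + (1/24) * e19
  have k25 : c 25 = (-1) * c 13 + (-1) * c 23 := by
    linear_combination (5) * e0 + (-1/4) * e1 + (-1/4) * e2 + (1/6) * e3 + (1/6) * e4 + (-1/4) * e5 + (1/6) * e6 + (1/6) * e7 + (1/2) * e8 + (-1/6) * e9 + (-1/6) * e10 + (-1/24) * e13 + (-1/24) * e14 + (-1/24) * e17 + (-1/24) * e18 + (1/24) * e24 + (1/24) * e25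
  have k26 : c 26 = (-1) * c 11 + (-1) * c 21 := by
    linear_combination (23/2) * e0 + (-1/2) * e1 + (1) * e2 + (1/3) * e3 + (1/3) * e4 + (1/4) * e5 + (4/3) * e6 + (1/4) * e8 + (-1/2) * e9 + (1/6) * e10 + (-1/2) * e11 + (1/6) * e12 + (-1/12) * e13 + (-1/12) * e14 + (-1/6) * e17 + (-1/30) * e18 + (-1/30) * e21 + (1/12) * e24 + (1/12) * e26
  have k27 : c 27 = (-1) * c 10 + (-1) * c 20 := by
    linear_combination (23/2) * e0 + (1) * e1 + (-1/2) * e2 + (4/3) * e3 + (1/4) * e5 + (1/3) * e6 + (1/3) * e7 + (1/4) * e8 + (1/6) * e9 + (-1/2) * e10 + (-1/2) * e11 + (1/6) * e12 + (-1/6) * e13 + (-1/30) * e14 + (-1/30) * e15 + (-1/12) * e17 + (-1/12) * e18 + (1/12) * e25 + (1/12) * e26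
  have k28 : c 28 = (1) * c 23 := by
    linear_combination (-8) * e0 + (4) * e1 + (1) * e2 + (-4/3) * e3 + (-4/3) * e4 + (4/3) * e5 + (1/4) * e6 + (1/4) * e7 + (-1/2) * e9 + (-1/2) * e10 + (1/6) * e11 + (1/6) * e12 + (1/12) * e13 + (1/12) * e14 + (-1/6) * e16 + (-1/30) * e19 + (-1/30) * e20 + (1/12) * e22 + (1/12) * e23
  have k29 : c 29 = 0 := by
    linear_combination (1/4) * e9 + (1/4) * e10 + (1/4) * e11 + (1/4) * e12
  have k30 : c 30 = (1) * c 13 := by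
    linear_combination (3) * e0 + (-15/4) * e1 + (-3/4) * e2 + (7/6) * e3 + (7/6) * e4 + (-13/12) * e5 + (-5/12) * e6 + (-5/12) * e7 + (-1/2) * e8 + (5/12) * e9 + (5/12) * e10 + (1/12) * e11 + (1/12) * e12 + (-1/24) * e13 + (-1/24) * e14 + (1/6) * e16 + (1/24) * e17 + (1/24) * e18 + (1/30) * e19 + (1/30) * e20 + (-1/12) * e22 + (-1/12) * e23 + (-1/24) * e24 + (-1/24) * e25
  have k31 : c 31 = (1) * c 21 := by
    linear_combination (-4) * e0 + (5/4) * e1 + (-1/4) * e2 + (-2/3) * e3 + (-2/3) * e4 + (1/6) * e5 + (-1/4) * e6 + (1/2) * e7 + (1/6) * e8 + (-1/6) * e9 + (-1/6) * e11 + (1/24) * e13 + (1/24) * e14 + (-1/24) * e16 + (-1/24) * e19 + (1/24) * e22 + (1/24) * e27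
  have k32 : c 32 = (1) * c 20 := by
    linear_combination (-2) * e0 + (17/2) * e1 + (-1/2) * e2 + (2/3) * e3 + (-2/3) * e4 + (1/3) * e5 + (1/4) * e6 + (1/4) * e7 + (1/3) * e8 + (1/6) * e9 + (-1/2) * e10 + (-1/2) * e11 + (1/6) * e12 + (1/30) * e14 + (-2/15) * e15 + (-1/12) * e16 + (-1/12) * e19 + (1/12) * e23 + (1/12) * e27
  have k33 : c 33 = (1) * c 11 := by
    linear_combination (-15/2) * e0 + (-3/4) * e1 + (-3/4) * e2 + (1/3) * e3 + (1/3) * e4 + (-5/12) * e5 + (-13/12) * e6 + (-1/2) * e7 + (-5/12) * e8 + (5/12) * e9 + (1/12) * e10 + (5/12) * e11 + (1/12) * e12 + (1/24) * e13 + (1/24) * e14 + (1/24) * e16 + (1/6) * e17 + (1/30) * e18 + (1/24) * e19 + (1/30) * e21 + (-1/24) * e22 + (-1/12) * e24 + (-1/12) * e26 + (-1/24) * e27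
  have k34 : c 34 = (1) * c 10 := by
    linear_combination (-19/2) * e0 + (-19/2) * e1 + (1) * e2 + (-2) * e3 + (2/3) * e4 + (-7/12) * e5 + (-7/12) * e6 + (-7/12) * e7 + (-7/12) * e8 + (-1/12) * e9 + (3/4) * e10 + (3/4) * e11 + (-1/12) * e12 + (1/6) * e13 + (1/6) * e15 + (1/12) * e16 + (1/12) * e17 + (1/12) * e18 + (1/12) * e19 + (-1/12) * e23 + (-1/12) * e25 + (-1/12) * e26 + (-1/12) * e27
  simp only [P35, k0, k1, k2, k3, k4, k5, k6, k7, k8, k12, k14, k15, k16, k17, k18, k19, k22, k24, k25, k26, k27, k28, k29, k30, k31, k32, k33, k34, Fin.sum_univ_seven]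
  simp [gc, gp]
  ring

set_option maxHeartbeats 4000000 in
theorem symm35 (c : Fin 5 × Fin 5 × Fin 5 → ℝ) : ∃ d : Fin 35 → ℝ, ∀ p q x y z : ℝ,
    ∑ t, c t * ((![p,q,x,y,z] : Fin 5 → ℝ) t.1 * (![p,q,x,y,z] : Fin 5 → ℝ) t.2.1 * (![p,q,x,y,z] : Fin 5 → ℝ) t.2.2) = P35 d p q x y z := by
  refine ⟨![c (0, 0, 0),
    c (0, 0, 1) + c (0, 1, 0) + c (1, 0, 0),
    c (0, 0, 2) + c (0, 2, 0) + c (2, 0, 0),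
    c (0, 0, 3) + c (0, 3, 0) + c (3, 0, 0),
    c (0, 0, 4) + c (0, 4, 0) + c (4, 0, 0),
    c (0, 1, 1) + c (1, 0, 1) + c (1, 1, 0),
    c (0, 1, 2) + c (0, 2, 1) + c (1, 0, 2) + c (1, 2, 0) + c (2, 0, 1) + c (2, 1, 0),
    c (0, 1, 3) + c (0, 3, 1) + c (1, 0, 3) + c (1, 3, 0) + c (3, 0, 1) + c (3, 1, 0),
    c (0, 1, 4) + c (0, 4, 1) + c (1, 0, 4) + c (1, 4, 0) + c (4, 0, 1) + c (4, 1, 0),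
    c (0, 2, 2) + c (2, 0, 2) + c (2, 2, 0),
    c (0, 2, 3) + c (0, 3, 2) + c (2, 0, 3) + c (2, 3, 0) + c (3, 0, 2) + c (3, 2, 0),
    c (0, 2, 4) + c (0, 4, 2) + c (2, 0, 4) + c (2, 4, 0) + c (4, 0, 2) + c (4, 2, 0),
    c (0, 3, 3) + c (3, 0, 3) + c (3, 3, 0),
    c (0, 3, 4) + c (0, 4, 3) + c (3, 0, 4) + c (3, 4, 0) + c (4, 0, 3) + c (4, 3, 0),
    c (0, 4, 4) + c (4, 0, 4) + c (4, 4, 0),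
    c (1, 1, 1),
    c (1, 1, 2) + c (1, 2, 1) + c (2, 1, 1),
    c (1, 1, 3) + c (1, 3, 1) + c (3, 1, 1),
    c (1, 1, 4) + c (1, 4, 1) + c (4, 1, 1),
    c (1, 2, 2) + c (2, 1, 2) + c (2, 2, 1),
    c (1, 2, 3) + c (1, 3, 2) + c (2, 1, 3) + c (2, 3, 1) + c (3, 1, 2) + c (3, 2, 1),
    c (1, 2, 4) + c (1, 4, 2) + c (2, 1, 4) + c (2, 4, 1) + c (4, 1, 2) + c (4, 2, 1),
    c (1, 3, 3) + c (3, 1, 3) + c (3, 3, 1),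
    c (1, 3, 4) + c (1, 4, 3) + c (3, 1, 4) + c (3, 4, 1) + c (4, 1, 3) + c (4, 3, 1),
    c (1, 4, 4) + c (4, 1, 4) + c (4, 4, 1),
    c (2, 2, 2),
    c (2, 2, 3) + c (2, 3, 2) + c (3, 2, 2),
    c (2, 2, 4) + c (2, 4, 2) + c (4, 2, 2),
    c (2, 3, 3) + c (3, 2, 3) + c (3, 3, 2),
    c (2, 3, 4) + c (2, 4, 3) + c (3, 2, 4) + c (3, 4, 2) + c (4, 2, 3) + c (4, 3, 2),
    c (2, 4, 4) + c (4, 2, 4) + c (4, 4, 2),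
    c (3, 3, 3),
    c (3, 3, 4) + c (3, 4, 3) + c (4, 3, 3),
    c (3, 4, 4) + c (4, 3, 4) + c (4, 4, 3),
    c (4, 4, 4)], fun p q x y z => ?_⟩
  simp [Fintype.sum_prod_type, Fin.sum_univ_five, P35]
  ring

/-- coordinates on N -/
def uN (i : Fin 5) (A : symTraceless 3) : ℝ :=
  (![A.1 0 0 - A.1 2 2, A.1 1 1 - A.1 2 2, A.1 0 1, A.1 0 2, A.1 1 2] : Fin 5 → ℝ) i

/-- the generators -/
def gN (i : Fin 7) (A : symTraceless 3) : ℝ :=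
  gp (uN 0 A) (uN 1 A) (uN 2 A) (uN 3 A) (uN 4 A) i

theorem uN_eq (A : symTraceless 3) :
    (fun i => uN i A) = ![uN 0 A, uN 1 A, uN 2 A, uN 3 A, uN 4 A] := by
  ext i; fin_cases i <;> rfl

theorem coord_mem (ij : Fin 3 × Fin 3) :
    (fun A : symTraceless 3 => A.1 ij.1 ij.2) ∈ Submodule.span ℝ (Set.range uN) := by
  rw [Submodule.mem_span_range_iff_exists_fun]
  have hs : ∀ (A : symTraceless 3) i j, A.1 i j = A.1 j i := fun A i j =>
    (mem_symTraceless.mp A.2).1.apply j i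
  have ht : ∀ A : symTraceless 3, A.1 0 0 + A.1 1 1 + A.1 2 2 = 0 := fun A => by
    have := (mem_symTraceless.mp A.2).2
    rwa [Matrix.trace_fin_three] at this
  obtain ⟨i, j⟩ := ij
  refine ⟨(![![![2/3,-1/3,0,0,0],![0,0,1,0,0],![0,0,0,1,0]],
    ![![0,0,1,0,0],![-1/3,2/3,0,0,0],![0,0,0,0,1]],
    ![![0,0,0,1,0],![0,0,0,0,1],![-1/3,-1/3,0,0,0]]] : Fin 3 → Fin 3 → Fin 5 → ℝ) i j, ?_⟩
  ext A
  have h1 := hs A 0 1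
  have h2 := hs A 0 2
  have h3 := hs A 1 2
  have h4 := ht A
  fin_cases i <;> fin_cases j <;> simp [Fin.sum_univ_five, uN] <;> linarith

theorem prod_mem_pow {σ R S : Type*} [CommRing R] [CommRing S] [Algebra R S] (L : Submodule R S)
    (v : σ → S) (hv : ∀ i, v i ∈ L) (d : σ → ℕ) (s : Finset σ) :
    ∏ i ∈ s, v i ^ d i ∈ L ^ (∑ i ∈ s, d i) := by
  classical
  induction s using Finset.induction_on with
  | empty =>
    rw [Finset.prod_empty, Finset.sum_empty, pow_zero]
    exact Submodule.one_le.mp le_rfl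
  | insert a s ha ih =>
    rw [Finset.prod_insert ha, Finset.sum_insert ha, pow_add]
    exact Submodule.mul_mem_mul (Submodule.pow_mem_pow _ (hv a) _) ih

theorem poly_mem (p : MvPolynomial (Fin 3 × Fin 3) ℝ) (hp : p.IsHomogeneous 3) :
    (fun A : symTraceless 3 => evalMat p A.1) ∈ (Submodule.span ℝ (Set.range uN)) ^ 3 := by
  have : (fun A : symTraceless 3 => evalMat p A.1) = ∑ d ∈ p.support, p.coeff d •
      ∏ ij : Fin 3 × Fin 3, (fun A : symTraceless 3 => A.1 ij.1 ij.2) ^ d ij := by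
    ext A
    simp [evalMat, MvPolynomial.eval_eq']
  rw [this]
  refine Submodule.sum_mem _ fun d hd => Submodule.smul_mem _ _ ?_
  have h3 : ∑ ij, d ij = 3 := by
    have := hp.degree_eq_sum_deg_support hd
    rw [← Finsupp.degree_eq_sum]
    exact this.symm
  have h4 := prod_mem_pow _ _ coord_mem d Finset.univ
  rw [h3] at h4
  exact h4

open scoped Pointwise in
theorem poly_35 (p : MvPolynomial (Fin 3 × Fin 3) ℝ) (hp : p.IsHomogeneous 3) :
    ∃ d : Fin 35 → ℝ, ∀ A : symTraceless 3,
      evalMat p A.1 = P35 d (uN 0 A) (uN 1 A) (uN 2 A) (uN 3 A) (uN 4 A) := by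
  have h := poly_mem p hp
  rw [pow_three, Submodule.span_mul_span, Submodule.span_mul_span] at h
  have hle : Submodule.span ℝ (Set.range uN * (Set.range uN * Set.range uN)) ≤
      Submodule.span ℝ (Set.range fun t : Fin 5 × Fin 5 × Fin 5 => uN t.1 * uN t.2.1 * uN t.2.2) := by
    apply Submodule.span_mono
    rintro _ ⟨_, ⟨i, rfl⟩, _, ⟨_, ⟨j, rfl⟩, _, ⟨k, rfl⟩, rfl⟩, rfl⟩
    exact ⟨(i, j, k), mul_assoc _ _ _⟩
  obtain ⟨c, hc⟩ := (Submodule.mem_span_range_iff_exists_fun ℝ).mp (hle h)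
  obtain ⟨d, hd⟩ := symm35 c
  refine ⟨d, fun A => ?_⟩
  rw [← hd, ← uN_eq]
  have := congrFun hc A
  simp only [Finset.sum_apply, Pi.smul_apply, Pi.mul_apply, smul_eq_mul] at this
  exact this.symm

/-- rank one point -/
noncomputable def ptN (r s t : ℝ) : symTraceless 3 :=
  ⟨!![r^2 - (r^2+s^2+t^2)/3, r*s, r*t; r*s, s^2 - (r^2+s^2+t^2)/3, s*t;
    r*t, s*t, t^2 - (r^2+s^2+t^2)/3], by
    refine mem_symTraceless.mpr ⟨?_, ?_⟩
    · ext i j; fin_cases i <;> fin_cases j <;> rfl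
    · rw [Matrix.trace_fin_three]; simp; ring⟩

theorem degen_ptN (r s t : ℝ) : Degen (ptN r s t) := by
  apply degen_of_quad _ (-(r^2+s^2+t^2)/3) (2*(r^2+s^2+t^2)/3)
  ext i j
  fin_cases i <;> fin_cases j <;>
    simp [ptN, Matrix.mul_apply, Fin.sum_univ_three] <;> ring

theorem idealF3_le : idealF3 ≤ Submodule.span ℝ (Set.range gN) := by
  rintro f ⟨⟨p, hp, hf⟩, hv⟩
  obtain ⟨d, hd⟩ := poly_35 p hp
  have hz : ∀ r s t : ℝ, P35 d (r^2-t^2) (s^2-t^2) (r*s) (r*t) (s*t) = 0 := by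
    intro r s t
    have := hv _ (degen_ptN r s t)
    rw [hf, hd] at this
    simpa [uN, ptN] using this
  rw [Submodule.mem_span_range_iff_exists_fun]
  refine ⟨gc d, ?_⟩
  ext A
  rw [hf, hd, core d hz]
  simp [gN]

/-- minors -/
theorem minor_exists (φ ψ : symTraceless 3 →ₗ[ℝ] ℝ) :
    ∃ ξ : Module.Dual ℝ ↥(⋀[ℝ]^2 ↥(symTraceless 3)), ∀ A B, ξ (wedge2 A B) = φ A * ψ B - ψ A * φ B := by
  let T : symTraceless 3 →ₗ[ℝ] (Fin 2 → ℝ) := LinearMap.pi ![φ, ψ]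
  refine ⟨exteriorPower.alternatingMapLinearEquiv
    ((Matrix.detRowAlternating (R := ℝ) (n := Fin 2)).compLinearMap T), fun A B => ?_⟩
  change exteriorPower.alternatingMapLinearEquiv _ (exteriorPower.ιMulti ℝ 2 ![A, B]) = _
  rw [exteriorPower.alternatingMapLinearEquiv_apply_ιMulti]
  change Matrix.det (fun i => T (![A, B] i)) = _
  refine (Matrix.det_fin_two _).trans ?_
  simp [T]

/-- linear coordinates -/
def uL (i : Fin 5) : symTraceless 3 →ₗ[ℝ] ℝ where
  toFun := uN i
  map_add' A B := by fin_cases i <;> simp [uN] <;> ring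
  map_smul' r A := by fin_cases i <;> simp [uN] <;> ring

theorem gN_minor (i : Fin 7) : ∃ ξ : Module.Dual ℝ ↥(⋀[ℝ]^2 ↥(symTraceless 3)),
    gN i = fun A => ξ (wedge2 A (H2 A)) := by
  obtain ⟨ξ, hξ⟩ := minor_exists (uL ((![0,0,1,0,1,0,1] : Fin 7 → Fin 5) i))
    (uL ((![1,2,2,3,3,4,4] : Fin 7 → Fin 5) i))
  refine ⟨ξ, ?_⟩
  ext A
  rw [hξ]
  have hs : ∀ i j, A.1 i j = A.1 j i := fun i j =>
    (mem_symTraceless.mp A.2).1.apply j i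
  have ht : A.1 0 0 + A.1 1 1 + A.1 2 2 = 0 := by
    have := (mem_symTraceless.mp A.2).2
    rwa [Matrix.trace_fin_three] at this
  have h1 := hs 1 0
  have h2 := hs 2 0
  have h3 := hs 2 1
  have h4 : A.1 2 2 = - A.1 0 0 - A.1 1 1 := by linarith
  have hH : ∀ k l, (H2 A).1 k l = ∑ m, A.1 k m * A.1 m l -
      (A.1 ^ 2).trace / 3 * (1 : Matrix (Fin 3) (Fin 3) ℝ) k l := by
    intro k l
    simp [H2, pow_two, Matrix.mul_apply]
  generalize (A.1 ^ 2).trace / 3 = τ at hH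
  fin_cases i <;> simp [gN, gp, uL, uN, hH, Fin.sum_univ_three, h1, h2, h3, h4] <;> ring

theorem gN_mem (i : Fin 7) : gN i ∈ idealF3 := by
  obtain ⟨ξ, hξ⟩ := gN_minor i
  rw [hξ]
  exact ⟨wedge_poly ξ, wedge_vanish ξ⟩

/-- general point -/
noncomputable def qN (p q x y z : ℝ) : symTraceless 3 :=
  ⟨!![(2*p-q)/3, x, y; x, (2*q-p)/3, z; y, z, -(p+q)/3], by
    refine mem_symTraceless.mpr ⟨?_, ?_⟩
    · ext i j; fin_cases i <;> fin_cases j <;> rfl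
    · rw [Matrix.trace_fin_three]; simp; ring⟩

theorem gN_qN (p q x y z : ℝ) (i : Fin 7) : gN i (qN p q x y z) = gp p q x y z i := by
  have h0 : uN 0 (qN p q x y z) = p := by simp [uN, qN]; ring
  have h1 : uN 1 (qN p q x y z) = q := by simp [uN, qN]; ring
  have h2 : uN 2 (qN p q x y z) = x := by simp [uN, qN]
  have h3 : uN 3 (qN p q x y z) = y := by simp [uN, qN]
  have h4 : uN 4 (qN p q x y z) = z := by simp [uN, qN]
  rw [gN, h0, h1, h2, h3, h4]

theorem gN_indep : LinearIndependent ℝ gN := by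
  rw [Fintype.linearIndependent_iff]
  intro c hc
  have key : ∀ p q x y z : ℝ, ∑ i, c i * gp p q x y z i = 0 := by
    intro p q x y z
    have := congrFun hc (qN p q x y z)
    simpa [gN_qN] using this
  have a0 := key 1 2 0 0 0
  have a1 := key 0 0 1 0 1
  have a2 := key 0 0 1 1 0
  have a3 := key 0 0 0 1 1
  have b1 := key 0 0 1 0 0
  have b2 := key 0 0 0 1 0
  have b3 := key 0 0 0 0 1
  have b4 := key 0 0 (-1) 0 1
  have b5 := key 0 0 1 (-1) 0
  have b6 := key 0 0 0 1 (-1)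
  simp [Fin.sum_univ_seven, gp] at a0 a1 a2 a3 b1 b2 b3 b4 b5 b6
  norm_num at a0
  intro i
  fin_cases i <;> simp <;> linarith

/-- For `n = 3`, the space of degree-3 homogeneous polynomial functions on `N` vanishing on
the degenerate matrices has dimension 7, and equals the span of the coordinate functions
`A ↦ ξ(A ∧ H₂(A))` of the wedge map, as `ξ` ranges over the linear forms on `⋀² N`. -/
theorem idealF3_finrank_eq_seven_and_span :
    Module.finrank ℝ ↥idealF3 = 7 ∧
    idealF3 = Submodule.span ℝ {f : ↥(symTraceless 3) → ℝ |
      ∃ ξ : Module.Dual ℝ ↥(⋀[ℝ]^2 ↥(symTraceless 3)),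
        f = fun A => ξ (wedge2 A (H2 A))} := by

  have hS : idealF3 = Submodule.span ℝ (Set.range gN) :=
    le_antisymm idealF3_le (Submodule.span_le.mpr (by rintro _ ⟨i, rfl⟩; exact gN_mem i))
  refine ⟨?_, le_antisymm ?_ ?_⟩
  · rw [hS, finrank_span_eq_card gN_indep]
    rfl
  · rw [hS]
    apply Submodule.span_mono
    rintro _ ⟨i, rfl⟩
    exact gN_minor i
  · rw [Submodule.span_le]
    rintro _ ⟨ξ, rfl⟩
    exact ⟨wedge_poly ξ, wedge_vanish ξ⟩
end

section
/- Let n ≥ 2 and set B = C(n(n+1)/2 − 1, n−1) (a binomial coefficient). Then there exist real polynomials p_1, …, p_B in the entries of an n×n symmetric matrix, each homogeneous of degree n(n−1)/2, such that δ(A) = p_1(A)² + ⋯ + p_B(A)² for every n×n real symmetric matrix A; in particular μ(n) ≤ C(n(n+1)/2 − 1, n−1). -/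
open Matrix BigOperators

theorem cb_aux (d m : ℕ) (C : Matrix (Fin m) (Fin d) ℝ) :
    det (C * Cᵀ) = ∑ f : Fin m → Fin d, (m.factorial : ℝ)⁻¹ * (det (C.submatrix id f)) ^ 2 := by
  have h1 : det (C * Cᵀ) = ∑ f : Fin m → Fin d,
      (∏ i, C i (f i)) * det (C.submatrix id f) := by
    have : C * Cᵀ = fun i => ∑ k : Fin d, C i k • (fun j => C j k) := by
      ext i j
      simp [Matrix.mul_apply]
    rw [this]
    have h := (detRowAlternating (n := Fin m) (R := ℝ)).toMultilinearMap.map_sum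
      (fun i (k : Fin d) => C i k • (fun j => C j k))
    refine h.trans (Finset.sum_congr rfl fun f _ => ?_)
    rw [MultilinearMap.map_smul_univ, smul_eq_mul, ← det_transpose (C.submatrix id f)]
    rfl
  have h2 : ∀ σ : Equiv.Perm (Fin m), det (C * Cᵀ) = ∑ f : Fin m → Fin d,
      ((Equiv.Perm.sign σ : ℤ) : ℝ) * (∏ i, C i (f (σ i))) * det (C.submatrix id f) := by
    intro σ
    rw [h1]
    rw [← Equiv.sum_comp (Equiv.arrowCongr σ.symm (Equiv.refl (Fin d)))]
    refine Finset.sum_congr rfl fun f _ => ?_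
    have : C.submatrix id ((Equiv.arrowCongr σ.symm (Equiv.refl (Fin d))) f)
      = (C.submatrix id f).submatrix id σ := by
      ext i j; simp [Equiv.arrowCongr]
    rw [this, det_permute']
    simp [Equiv.arrowCongr]
    ring
  have h3 : (m.factorial : ℝ) * det (C * Cᵀ)
      = ∑ f : Fin m → Fin d, (det (C.submatrix id f)) ^ 2 := by
    have : (m.factorial : ℝ) * det (C * Cᵀ) = ∑ σ : Equiv.Perm (Fin m), det (C * Cᵀ) := by
      simp [Fintype.card_perm]
    rw [this, Finset.sum_congr rfl (fun σ _ => h2 σ), Finset.sum_comm]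
    refine Finset.sum_congr rfl fun f _ => ?_
    rw [← Finset.sum_mul, sq]
    congr 1
    rw [← det_transpose, det_apply']
    simp
  rw [← Finset.mul_sum, ← h3, inv_mul_cancel_left₀]
  positivity

theorem det_sq_eq {d m : ℕ} (C : Matrix (Fin m) (Fin d) ℝ) (f g : Fin m → Fin d)
    (hf : Function.Injective f) (hg : Function.Injective g) (h : Set.range f = Set.range g) :
    (det (C.submatrix id f)) ^ 2 = (det (C.submatrix id g)) ^ 2 := by
  let σ : Equiv.Perm (Fin m) :=
    (Equiv.ofInjective f hf).trans ((Equiv.setCongr h).trans (Equiv.ofInjective g hg).symm)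
  have hσ : ∀ i, g (σ i) = f i := by
    intro i
    have := Equiv.apply_ofInjective_symm hg ((Equiv.setCongr h) (Equiv.ofInjective f hf i))
    simpa [σ] using this
  have : C.submatrix id f = (C.submatrix id g).submatrix id σ := by
    ext i j; simp [hσ]
  rw [this, det_permute', mul_pow]
  rcases Int.units_eq_one_or (Equiv.Perm.sign σ) with h | h <;> simp [h]

theorem cb (d m : ℕ) (hd : 0 < d) : ∃ (c : Finset (Fin d) → ℝ) (g : Finset (Fin d) → Fin m → Fin d),
    ∀ C : Matrix (Fin m) (Fin d) ℝ, det (C * Cᵀ) =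
      ∑ s ∈ Finset.powersetCard m Finset.univ, (c s * det (C.submatrix id (g s))) ^ 2 := by
  classical
  let f0 : Fin m → Fin d := fun _ => ⟨0, hd⟩
  let g : Finset (Fin d) → Fin m → Fin d := fun s =>
    if h : ∃ f : Fin m → Fin d, Function.Injective f ∧ Finset.univ.image f = s then h.choose else f0
  have hg : ∀ f : Fin m → Fin d, Function.Injective f →
      Function.Injective (g (Finset.univ.image f)) ∧
      Finset.univ.image (g (Finset.univ.image f)) = Finset.univ.image f := by
    intro f hf
    have h : ∃ f' : Fin m → Fin d, Function.Injective f' ∧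
      Finset.univ.image f' = Finset.univ.image f := ⟨f, hf, rfl⟩
    simp only [g, dif_pos h]
    exact h.choose_spec
  let S : Finset (Fin d) → Finset (Fin m → Fin d) := fun s =>
    Finset.univ.filter fun f => Function.Injective f ∧ Finset.univ.image f = s
  refine ⟨fun s => √((m.factorial : ℝ)⁻¹ * (S s).card), g, fun C => ?_⟩
  rw [cb_aux, ← Finset.sum_filter_of_ne (p := fun f : Fin m → Fin d => Function.Injective f)]
  · rw [← Finset.sum_fiberwise_of_maps_to (g := fun f : Fin m → Fin d => Finset.univ.image f)
      (t := Finset.powersetCard m Finset.univ)]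
    · refine Finset.sum_congr rfl fun s _ => ?_
      rw [mul_pow, Real.sq_sqrt (by positivity), Finset.filter_filter]
      rw [Finset.sum_congr rfl (g := fun _ => (m.factorial : ℝ)⁻¹ *
        (det (C.submatrix id (g s))) ^ 2)]
      · rw [Finset.sum_const, nsmul_eq_mul]; ring
      · intro f hf
        obtain ⟨hinj, rfl⟩ := (Finset.mem_filter.mp hf).2
        obtain ⟨h1, h2⟩ := hg f hinj
        rw [det_sq_eq C f _ hinj h1]
        have := congrArg (fun s : Finset (Fin d) => (s : Set (Fin d))) h2
        simpa using this.symm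
    · intro f hf
      rw [Finset.mem_powersetCard]
      refine ⟨Finset.subset_univ _, ?_⟩
      rw [Finset.card_image_of_injective _ (Finset.mem_filter.mp hf).2]
      simp
  · intro f _ h
    by_contra hf
    apply h
    rw [Function.Injective] at hf
    push Not at hf
    obtain ⟨i, j, hij, hne⟩ := hf
    rw [det_zero_of_column_eq hne (fun k => by simp [hij])]
    simp

theorem frame (m : ℕ) : ∃ d ≤ (m + 1) * (m + 2) / 2 - 1,
    ∃ e : Fin d → Matrix (Fin (m + 1)) (Fin (m + 1)) ℝ, (∀ k, (e k).trace = 0) ∧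
    ∀ X Y : Matrix (Fin (m + 1)) (Fin (m + 1)) ℝ, X.IsSymm → Y.IsSymm → X.trace = 0 →
      Y.trace = 0 → ∑ k, (∑ a, ∑ b, e k a b * X a b) * (∑ a, ∑ b, e k a b * Y a b)
        = ∑ a, ∑ b, X a b * Y a b := by
  classical
  let N : Submodule ℝ (EuclideanSpace ℝ (Fin (m + 1) × Fin (m + 1))) :=
    { carrier := {x | (∀ i j, x (i, j) = x (j, i)) ∧ ∑ i, x (i, i) = 0}
      add_mem' := by
        rintro x y ⟨h1, h2⟩ ⟨h3, h4⟩
        refine ⟨fun i j => ?_, ?_⟩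
        · simp [h1 i j, h3 i j]
        · simp [Finset.sum_add_distrib, h2, h4]
      zero_mem' := by simp
      smul_mem' := by
        rintro c x ⟨h1, h2⟩
        refine ⟨fun i j => ?_, ?_⟩
        · simp [h1 i j]
        · simp [← Finset.mul_sum, h2] }
  have hN : ∀ x, x ∈ N ↔ (∀ i j, x (i, j) = x (j, i)) ∧ ∑ i, x (i, i) = 0 := fun x => Iff.rfl
  let b := stdOrthonormalBasis ℝ N
  refine ⟨Module.finrank ℝ N, ?_, fun k => Matrix.of fun i j => (b k : EuclideanSpace ℝ _) (i, j),
    ?_, ?_⟩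
  · let T := {p : Fin (m + 1) × Fin (m + 1) // p.1 ≤ p.2 ∧ p ≠ (0, 0)}
    let φ : N →ₗ[ℝ] (T → ℝ) :=
      { toFun := fun x t => (x : EuclideanSpace ℝ _) t.1
        map_add' := by intros; ext; simp
        map_smul' := by intros; ext; simp }
    have hφ : Function.Injective φ := by
      rw [← LinearMap.ker_eq_bot, LinearMap.ker_eq_bot']
      rintro ⟨x, hx⟩ h
      obtain ⟨h1, h2⟩ := (hN x).1 hx
      have h3 : ∀ i j : Fin (m + 1), i ≤ j → (i, j) ≠ (0, 0) → x (i, j) = 0 := by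
        intro i j hij h0
        exact congrFun h ⟨(i, j), hij, h0⟩
      have h4 : x (0, 0) = 0 := by
        rw [Fin.sum_univ_succ] at h2
        rw [Finset.sum_eq_zero] at h2
        · simpa using h2
        · intro i _
          exact h3 _ _ le_rfl (by simp [Fin.succ_ne_zero])
      have h5 : ∀ i j : Fin (m + 1), i ≤ j → x (i, j) = 0 := by
        intro i j hij
        by_cases h0 : (i, j) = (0, 0)
        · rw [h0, h4]
        · exact h3 i j hij h0
      ext ⟨i, j⟩
      rcases le_total i j with hij | hij
      · exact h5 i j hij
      · exact (h1 i j).trans (h5 j i hij)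
    have := LinearMap.finrank_le_finrank_of_injective hφ
    rw [Module.finrank_fintype_fun_eq_card] at this
    refine this.trans ?_
    have hc : Fintype.card T + 1 ≤ (m + 1) * (m + 2) / 2 := by
      have e1 : Fintype.card T = ((Finset.univ.filter
        fun p : Fin (m + 1) × Fin (m + 1) => p.1 ≤ p.2).erase (0, 0)).card := by
        rw [Fintype.card_subtype]
        congr 1
        ext p; simp [and_comm]
      rw [e1, Finset.card_erase_add_one (by simp)]
      have e2 : (Finset.univ.filter fun p : Fin (m + 1) × Fin (m + 1) => p.1 ≤ p.2).card
          = ∑ j : Fin (m + 1), ((j : ℕ) + 1) := by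
        rw [Finset.card_filter, ← Finset.univ_product_univ, Finset.sum_product_right]
        refine Finset.sum_congr rfl fun j _ => ?_
        rw [← Finset.card_filter]
        have : (Finset.univ.filter fun i : Fin (m + 1) => i ≤ j) = Finset.Iic j := by
          ext; simp
        simp [this]
      rw [e2, Fin.sum_univ_eq_sum_range (fun j => j + 1)]
      have := Finset.sum_range_id_mul_two (m + 2)
      rw [Finset.sum_range_succ'] at this
      simp at this
      rw [Nat.le_div_iff_mul_le (by norm_num), this]
      apply le_of_eq; ring
    omega
  · intro k
    exact ((hN _).1 (b k).2).2
  · intro X Y hX hY tX tY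
    let v : ∀ Z : Matrix (Fin (m + 1)) (Fin (m + 1)) ℝ, Z.IsSymm → Z.trace = 0 → N :=
      fun Z h1 h2 => ⟨WithLp.toLp 2 fun p => Z p.1 p.2,
        (hN _).2 ⟨fun i j => (h1.apply i j).symm, h2⟩⟩
    have := b.sum_inner_mul_inner (v X hX tX) (v Y hY tY)
    simp only [Submodule.coe_inner, PiLp.inner_apply, Fintype.sum_prod_type, v] at this
    simp only [Real.inner_apply] at this
    rw [← this]
    refine Finset.sum_congr rfl fun k _ => ?_
    congr 1
    refine Finset.sum_congr rfl fun a _ => Finset.sum_congr rfl fun b _ => ?_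
    exact mul_comm _ _

theorem trace_pow_eq {n : ℕ} {A : Matrix (Fin n) (Fin n) ℝ} (hA : A.IsHermitian) (k : ℕ) :
    (A ^ k).trace = ∑ i, hA.eigenvalues i ^ k := by
  conv_lhs => rw [hA.spectral_theorem, ← map_pow, Unitary.conjStarAlgAut_apply, trace_mul_cycle,
    Unitary.coe_star_mul_self, Matrix.one_mul, diagonal_pow, trace_diagonal]
  simp

theorem disc_eq_det {n : ℕ} {A : Matrix (Fin n) (Fin n) ℝ} (hA : A.IsHermitian) :
    disc A hA = det (Matrix.of fun i j : Fin n => (A ^ ((i : ℕ) + j)).trace) := by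
  have : (Matrix.of fun i j : Fin n => (A ^ ((i : ℕ) + j)).trace)
      = (vandermonde hA.eigenvalues)ᵀ * vandermonde hA.eigenvalues := by
    ext i j
    rw [of_apply, trace_pow_eq hA]
    simp [Matrix.mul_apply, vandermonde_apply, pow_add]
  rw [this, det_mul, det_transpose, det_vandermonde, ← sq, disc]
  simp_rw [← Finset.prod_pow]
  refine Finset.prod_congr rfl fun i _ => Finset.prod_congr rfl fun j _ => ?_
  ring

theorem schur (m : ℕ) (t : ℕ → ℝ) (h0 : t 0 = m + 1) :
    det (Matrix.of fun i j : Fin (m + 1) => t ((i : ℕ) + j)) = (m + 1) *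
      det (Matrix.of fun i j : Fin m => t ((i : ℕ) + 1 + (j + 1))
        - t (i + 1) * t (j + 1) / (m + 1)) := by
  have hm : (m + 1 : ℝ) ≠ 0 := by positivity
  rw [det_eq_of_forall_row_eq_smul_add_const
    (B := Matrix.of fun i j : Fin (m + 1) => t ((i : ℕ) + j)
      - (if i = 0 then 0 else t i / (m + 1)) * t j)
    (fun i => if i = 0 then 0 else t i / (m + 1)) 0 (by simp)]
  · rw [det_succ_column_zero, Fin.sum_univ_succ, Finset.sum_eq_zero]
    · simp only [Fin.val_zero, pow_zero, one_mul, of_apply, add_zero, if_true, zero_mul, sub_zero, h0]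
      congr 2
      ext i j
      simp [Fin.succ_ne_zero]
      ring
    · intro i _
      simp [Fin.succ_ne_zero, h0]
      field_simp; simp
  · intro i j
    simp

theorem gram (m : ℕ) (A : Matrix (Fin (m + 1)) (Fin (m + 1)) ℝ) (hA : A.IsSymm)
    {d : ℕ} (e : Fin d → Matrix (Fin (m + 1)) (Fin (m + 1)) ℝ) (he : ∀ k, (e k).trace = 0)
    (hP : ∀ X Y : Matrix (Fin (m + 1)) (Fin (m + 1)) ℝ, X.IsSymm → Y.IsSymm → X.trace = 0 →
      Y.trace = 0 → ∑ k, (∑ a, ∑ b, e k a b * X a b) * (∑ a, ∑ b, e k a b * Y a b)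
        = ∑ a, ∑ b, X a b * Y a b)
    (C : Matrix (Fin m) (Fin d) ℝ)
    (hC : ∀ i k, C i k = ∑ a, ∑ b, e k a b * (A ^ ((i : ℕ) + 1)) a b) :
    disc A (isHermitian_of_isSymm hA) = (m + 1) * det (C * Cᵀ) := by
  rw [disc_eq_det, schur m (fun k => (A ^ k).trace) (by simp)]
  congr 2
  have hm : (m + 1 : ℝ) ≠ 0 := by positivity
  have hs : ∀ i, (Hmat A i).IsSymm := fun i => by
    unfold Hmat
    exact (hA.pow i).sub (isSymm_one.smul _)
  have ht : ∀ i, (Hmat A i).trace = 0 := fun i => by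
    simp [Hmat, trace_sub, trace_smul]
    field_simp; simp
  have hC' : ∀ i k, C i k = ∑ a, ∑ b, e k a b * (Hmat A ((i : ℕ) + 1)) a b := by
    intro i k
    have h := he k
    simp only [Matrix.trace, Matrix.diag] at h
    simp only [hC, Hmat, Matrix.sub_apply, Matrix.smul_apply, Matrix.one_apply, mul_sub, Finset.sum_sub_distrib]
    simp [← Finset.sum_mul, h]
  ext i j
  rw [Matrix.mul_apply]
  simp only [transpose_apply, hC', of_apply]
  rw [hP _ _ (hs _) (hs _) (ht _) (ht _)]
  have : ∑ a, ∑ b, Hmat A ((i : ℕ) + 1) a b * Hmat A ((j : ℕ) + 1) a b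
      = (Hmat A ((i : ℕ) + 1) * Hmat A ((j : ℕ) + 1)).trace := by
    simp only [Matrix.trace, Matrix.diag, Matrix.mul_apply]
    refine Finset.sum_congr rfl fun a _ => Finset.sum_congr rfl fun b _ => ?_
    rw [(hs ((j : ℕ) + 1)).apply]
  rw [this]
  simp only [Hmat, Matrix.sub_mul, Matrix.mul_sub, trace_sub, ← pow_add]
  simp
  field_simp
  ring

theorem pad {σ : Type*} {ι : Type*} (S : Finset ι) (B N : ℕ) (hB : S.card ≤ B)
    (F : ι → MvPolynomial σ ℝ) (hF : ∀ s, (F s).IsHomogeneous N) :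
    ∃ p : Fin B → MvPolynomial σ ℝ, (∀ i, (p i).IsHomogeneous N) ∧
      ∀ x, ∑ s ∈ S, (MvPolynomial.eval x (F s)) ^ 2 = ∑ i, (MvPolynomial.eval x (p i)) ^ 2 := by
  classical
  let e : Fin S.card ↪ Fin B := Fin.castLEEmb hB
  refine ⟨fun i => if h : (i : ℕ) < S.card then F (S.equivFin.symm ⟨i, h⟩) else 0, ?_, ?_⟩
  · intro i
    dsimp only
    split_ifs
    · exact hF _
    · exact MvPolynomial.isHomogeneous_zero _ _ _
  · intro x
    rw [← Finset.sum_coe_sort, ← Equiv.sum_comp S.equivFin.symm]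
    refine Finset.sum_of_injOn e e.injective.injOn (by simp) ?_ ?_
    · intro i _ hi
      have : ¬ (i : ℕ) < S.card := fun h => hi ⟨⟨i, h⟩, by simp, by ext; simp [e]⟩
      simp [this]
    · intro i _
      simp [e]

theorem hom_pow {n : ℕ} (k : ℕ) (a b : Fin n) :
    (((Matrix.of fun i j => MvPolynomial.X (i, j) :
      Matrix (Fin n) (Fin n) (MvPolynomial (Fin n × Fin n) ℝ)) ^ k) a b).IsHomogeneous k := by
  induction k generalizing a b with
  | zero =>
    rw [pow_zero, Matrix.one_apply]
    split_ifs
    · exact MvPolynomial.isHomogeneous_one _ _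
    · exact MvPolynomial.isHomogeneous_zero _ _ _
  | succ k ih =>
    rw [pow_succ, Matrix.mul_apply]
    exact MvPolynomial.IsHomogeneous.sum _ _ _ fun c _ =>
      (ih a c).mul (MvPolynomial.isHomogeneous_X _ _)

theorem hom_det {σ : Type*} {m : ℕ} (P : Matrix (Fin m) (Fin m) (MvPolynomial σ ℝ))
    (hP : ∀ i j, (P i j).IsHomogeneous ((i : ℕ) + 1)) :
    P.det.IsHomogeneous ((m + 1) * m / 2) := by
  have hs : (m + 1) * m / 2 = ∑ i : Fin m, ((i : ℕ) + 1) := by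
    rw [Fin.sum_univ_eq_sum_range (fun j => j + 1)]
    have := Finset.sum_range_id_mul_two (m + 1)
    rw [Finset.sum_range_succ'] at this
    simp at this
    rw [← this]; simp
  rw [← det_transpose, det_apply', hs]
  refine MvPolynomial.IsHomogeneous.sum _ _ _ fun s _ => ?_
  have h2 := MvPolynomial.IsHomogeneous.prod Finset.univ (fun i => P i (s i)) _
    (fun i _ => hP i (s i))
  have h3 := h2.C_mul (((Equiv.Perm.sign s : ℤ) : ℝ))
  simpa using h3

theorem discriminant_sum_of_squares_binom (n : ℕ) (hn : 2 ≤ n) :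
    ∃ p : Fin (Nat.choose (n * (n + 1) / 2 - 1) (n - 1)) →
        MvPolynomial (Fin n × Fin n) ℝ,
      (∀ i, (p i).IsHomogeneous (n * (n - 1) / 2)) ∧
      ∀ (A : Matrix (Fin n) (Fin n) ℝ) (hA : A.IsSymm),
        disc A (isHermitian_of_isSymm hA) = ∑ i, (evalMat (p i) A) ^ 2 := by
  obtain ⟨m, rfl⟩ : ∃ m, n = m + 1 := ⟨n - 1, by omega⟩
  obtain ⟨d, hd, e, he, hP⟩ := frame m
  have hm0 : 0 < m := by omega
  rcases Nat.eq_zero_or_pos d with rfl | hd0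
  · refine ⟨0, fun i => MvPolynomial.isHomogeneous_zero _ _ _, fun A hA => ?_⟩
    have : Nonempty (Fin m) := ⟨⟨0, hm0⟩⟩
    rw [gram m A hA e he hP 0 (fun i k => k.elim0)]
    simp [evalMat, det_zero]
  obtain ⟨c, g, hcg⟩ := cb d m hd0
  let M : Matrix (Fin (m + 1)) (Fin (m + 1)) (MvPolynomial (Fin (m + 1) × Fin (m + 1)) ℝ) :=
    Matrix.of fun i j => MvPolynomial.X (i, j)
  let P : Matrix (Fin m) (Fin d) (MvPolynomial (Fin (m + 1) × Fin (m + 1)) ℝ) :=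
    Matrix.of fun i k => ∑ a, ∑ b, MvPolynomial.C (e k a b) * (M ^ ((i : ℕ) + 1)) a b
  have hPh : ∀ i k, (P i k).IsHomogeneous ((i : ℕ) + 1) := by
    intro i k
    simp only [P, of_apply]
    exact MvPolynomial.IsHomogeneous.sum _ _ _ fun a _ => MvPolynomial.IsHomogeneous.sum _ _ _
      fun b _ => (hom_pow _ a b).C_mul _
  let F : Finset (Fin d) → MvPolynomial (Fin (m + 1) × Fin (m + 1)) ℝ := fun s =>
    MvPolynomial.C (√(m + 1) * c s) * (P.submatrix id (g s)).det
  obtain ⟨p, hp1, hp2⟩ := pad (Finset.powersetCard m (Finset.univ : Finset (Fin d)))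
    (Nat.choose ((m + 1) * (m + 1 + 1) / 2 - 1) (m + 1 - 1)) ((m + 1) * (m + 1 - 1) / 2)
    (by
      rw [Finset.card_powersetCard, Finset.card_univ, Fintype.card_fin]
      exact Nat.choose_le_choose _ hd) F
    (fun s => (hom_det _ fun i j => hPh i (g s j)).C_mul _)
  refine ⟨p, hp1, fun A hA => ?_⟩
  unfold evalMat
  rw [← hp2]
  let ev := MvPolynomial.eval (fun ij : Fin (m + 1) × Fin (m + 1) => A ij.1 ij.2)
  have hM : ∀ k a b, ev ((M ^ k) a b) = (A ^ k) a b := by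
    intro k a b
    have h1 : ev.mapMatrix M = A := by
      ext i j; simp [M, ev]
    have h2 : ev.mapMatrix (M ^ k) = A ^ k := by rw [map_pow, h1]
    exact congrFun (congrFun h2 a) b
  rw [gram m A hA e he hP (P.map ev) (by
    intro i k
    simp only [map_apply, P, of_apply, map_sum, map_mul, hM]
    simp [ev]), hcg, Finset.mul_sum]
  refine Finset.sum_congr rfl fun s _ => ?_
  change _ = (ev (F s)) ^ 2
  have : ev (F s) = √(m + 1) * c s * det ((P.map ev).submatrix id (g s)) := by
    simp only [F, map_mul, RingHom.map_det]
    congr 1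
    simp [ev]
  rw [this, mul_assoc, mul_pow √(m + 1 : ℝ), Real.sq_sqrt (by positivity)]
end
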